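/- Let G be a graph with no long theta, and let K be a tidy shortest long near-prism in G with constituent paths P1, P2, P3. Let x, y, z be K-major vertices such that y and z are both distant from x and y, z are nonadjacent. Then for all distinct i, j, k ∈ {1,2,3}, either there is no induced yz-path of G of length at least ℓ−2 with interior contained in A_{i,j}(x), or there is no induced yz-path of G of length at least ℓ−2 with interior contained in V(P_k). -/

import Mathlib

open SimpleGraph

namespace LEH

open scoped Classical

variable {V : Type*}

/-- `X` is anticomplete to `Y`: they are disjoint and there are no edges between them. -/
def Anticomplete (G : SimpleGraph V) (X Y : Set V) : Prop :=
  ∀ ⦃x⦄, x ∈ X → ∀ ⦃y⦄, y ∈ Y → x ≠ y ∧ ¬ G.Adj x y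

/-- The vertex set of a walk. -/
def vset {G : SimpleGraph V} {u v : V} (P : G.Walk u v) : Set V :=
  {x | x ∈ P.support}

/-- The interior of a path: its non-end vertices. -/
def inter {G : SimpleGraph V} {u v : V} (P : G.Walk u v) : Set V :=
  {x | x ∈ P.support ∧ x ≠ u ∧ x ≠ v}

/-- An induced path in `G`. -/
def IsInducedPath {G : SimpleGraph V} {u v : V} (P : G.Walk u v) : Prop :=
  P.IsPath ∧ ∀ x ∈ P.support, ∀ y ∈ P.support, G.Adj x y → s(x, y) ∈ P.edges

/-- A hole: an induced cycle of length at least 4. -/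
def IsHole {G : SimpleGraph V} {u : V} (c : G.Walk u u) : Prop :=
  c.IsCycle ∧ 4 ≤ c.length ∧
    ∀ x ∈ c.support, ∀ y ∈ c.support, G.Adj x y → s(x, y) ∈ c.edges

/-- A long even hole: a hole of even length at least `ℓ`. -/
def IsLongEvenHole (ℓ : ℕ) {G : SimpleGraph V} {u : V} (c : G.Walk u u) : Prop :=
  IsHole c ∧ ℓ ≤ c.length ∧ Even c.length

def HasLongEvenHole (G : SimpleGraph V) (ℓ : ℕ) : Prop :=
  ∃ (u : V) (c : G.Walk u u), IsLongEvenHole ℓ c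

/-- A long theta in `G`: two nonadjacent vertices joined by three internally disjoint
induced paths with no edges between their interiors, any two of which form a long hole. -/
def HasLongTheta (G : SimpleGraph V) (ℓ : ℕ) : Prop :=
  ∃ (u v : V) (P₁ P₂ P₃ : G.Walk u v),
    u ≠ v ∧ ¬ G.Adj u v ∧
    IsInducedPath P₁ ∧ IsInducedPath P₂ ∧ IsInducedPath P₃ ∧
    Anticomplete G (inter P₁) (inter P₂) ∧
    Anticomplete G (inter P₁) (inter P₃) ∧
    Anticomplete G (inter P₂) (inter P₃) ∧
    ℓ ≤ P₁.length + P₂.length ∧ ℓ ≤ P₁.length + P₃.length ∧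
    ℓ ≤ P₂.length + P₃.length

/-- A long jewel of order `k` formed by `Q₁, Q₂, P`. -/
def IsLongJewel (ℓ k : ℕ) {G : SimpleGraph V} {u v : V}
    (Q₁ Q₂ P : G.Walk u v) : Prop :=
  u ≠ v ∧
  IsInducedPath Q₁ ∧ IsInducedPath Q₂ ∧ IsInducedPath P ∧
  ¬ (Even Q₁.length ↔ Even Q₂.length) ∧
  max Q₁.support.length Q₂.support.length = k ∧
  ℓ ≤ P.length + min Q₁.length Q₂.length ∧
  Anticomplete G (inter P) (inter Q₁ ∪ inter Q₂)

def HasLongJewel (G : SimpleGraph V) (ℓ k : ℕ) : Prop :=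
  ∃ (u v : V) (Q₁ Q₂ P : G.Walk u v), IsLongJewel ℓ k Q₁ Q₂ P

/-- A long ban-the-bomb in `G`. -/
def IsLongBanTheBomb (ℓ : ℕ) {G : SimpleGraph V} (u v₁ w v₂ x : V)
    (P₁ : G.Walk x v₁) (P₂ : G.Walk x v₂) : Prop :=
  G.Adj u v₁ ∧ G.Adj v₁ w ∧ G.Adj w v₂ ∧ G.Adj v₂ u ∧ ¬ G.Adj v₁ v₂ ∧ u ≠ w ∧
  G.Adj x u ∧ ¬ G.Adj x v₁ ∧ ¬ G.Adj x v₂ ∧ ¬ G.Adj x w ∧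
  x ≠ v₁ ∧ x ≠ v₂ ∧ x ≠ w ∧
  IsInducedPath P₁ ∧ IsInducedPath P₂ ∧
  2 ≤ P₁.length ∧ 2 ≤ P₂.length ∧
  Anticomplete G (inter P₁) {u, w} ∧ Anticomplete G (inter P₂) {u, w} ∧
  Anticomplete G (vset P₁ \ {x}) (vset P₂ \ {x}) ∧
  ℓ ≤ P₁.length + 2 ∧ ℓ ≤ P₂.length + 2 ∧ ℓ ≤ P₁.length + P₂.length + 2

def HasLongBanTheBomb (G : SimpleGraph V) (ℓ : ℕ) : Prop :=
  ∃ (u v₁ w v₂ x : V) (P₁ : G.Walk x v₁) (P₂ : G.Walk x v₂),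
    IsLongBanTheBomb ℓ u v₁ w v₂ x P₁ P₂

/-- The induced subgraph of `G` on the vertex set `S` is a long hole. -/
def IsLongHoleOn (G : SimpleGraph V) (ℓ : ℕ) (S : Set V) : Prop :=
  ∃ (u : V) (c : G.Walk u u), IsHole c ∧ ℓ ≤ c.length ∧ {x | x ∈ c.support} = S

/-- A long near-prism with triangles `{a 0, a 1, a 2}`, `{b 0, b 1, b 2}` and
constituent paths `P 0, P 1, P 2`. -/
def IsLongNearPrism (ℓ : ℕ) {G : SimpleGraph V} (a b : Fin 3 → V)
    (P : ∀ i : Fin 3, G.Walk (a i) (b i)) : Prop :=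
  (∀ i j, i ≠ j → G.Adj (a i) (a j)) ∧
  (∀ i j, i ≠ j → G.Adj (b i) (b j)) ∧
  (Set.range a ∩ Set.range b).Subsingleton ∧
  (∀ i, (P i).IsPath) ∧
  (∀ i j, i ≠ j → ∀ x, x ∈ (P i).support → x ∉ (P j).support) ∧
  (∀ i j, i ≠ j → IsLongHoleOn G ℓ (vset (P i) ∪ vset (P j)))

def HasLongNearPrism (G : SimpleGraph V) (ℓ : ℕ) : Prop :=
  ∃ (a b : Fin 3 → V) (P : ∀ i : Fin 3, G.Walk (a i) (b i)), IsLongNearPrism ℓ a b P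

/-- A prospect: no long even hole of length at most `2ℓ`, no long jewel of order at most
`ℓ+1`, no long theta and no long ban-the-bomb. -/
def Prospect (G : SimpleGraph V) (ℓ : ℕ) : Prop :=
  (¬ ∃ (u : V) (c : G.Walk u u), IsLongEvenHole ℓ c ∧ c.length ≤ 2 * ℓ) ∧
  (¬ ∃ k ≤ ℓ + 1, HasLongJewel G ℓ k) ∧
  ¬ HasLongTheta G ℓ ∧ ¬ HasLongBanTheBomb G ℓ

/-- A candidate : a prospect with no long near-prism. -/
def Candidate (G : SimpleGraph V) (ℓ : ℕ) : Prop :=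
  Prospect G ℓ ∧ ¬ HasLongNearPrism G ℓ

/-- The vertex set of a near-prism. -/
def prismSupport {G : SimpleGraph V} {a b : Fin 3 → V}
    (P : ∀ i : Fin 3, G.Walk (a i) (b i)) : Set V :=
  ⋃ i, vset (P i)

/-- The near-prism, as a graph on `V`. -/
def prismGraph (G : SimpleGraph V) (a b : Fin 3 → V)
    (P : ∀ i : Fin 3, G.Walk (a i) (b i)) : SimpleGraph V :=
  SimpleGraph.fromEdgeSet
    ({e | ∃ i j, i ≠ j ∧ e = s(a i, a j)} ∪ {e | ∃ i j, i ≠ j ∧ e = s(b i, b j)} ∪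
      {e | ∃ i, e ∈ (P i).edges})

/-- `q` is `K`-major: `q` is outside the near-prism `K`, and no path of `K` with at most
three vertices contains all neighbours of `q` in `V(K)`. -/
def KMajor (G : SimpleGraph V) {a b : Fin 3 → V}
    (P : ∀ i : Fin 3, G.Walk (a i) (b i)) (q : V) : Prop :=
  q ∉ prismSupport P ∧
  ¬ ∃ (x y : V) (W : (prismGraph G a b P).Walk x y), W.IsPath ∧ W.length ≤ 2 ∧
      ∀ z ∈ prismSupport P, G.Adj q z → z ∈ W.support

/-- A shortest long near-prism. -/
def ShortestLNP (G : SimpleGraph V) (ℓ : ℕ) {a b : Fin 3 → V}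
    (P : ∀ i : Fin 3, G.Walk (a i) (b i)) : Prop :=
  IsLongNearPrism ℓ a b P ∧
  ∀ (a' b' : Fin 3 → V) (P' : ∀ i : Fin 3, G.Walk (a' i) (b' i)),
    IsLongNearPrism ℓ a' b' P' → (prismSupport P).ncard ≤ (prismSupport P').ncard

/-- The interior `F_K*` of the frame of a long near-prism: for each constituent path,
either the whole path (if it has length at most `ℓ-1`), or the non-end vertices of the
two stubs of length `ℓ/2 - 1` at its two ends. -/
def frameStar (ℓ : ℕ) {G : SimpleGraph V} {a b : Fin 3 → V}
    (P : ∀ i : Fin 3, G.Walk (a i) (b i)) : Set V :=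
  ⋃ i,
    if (P i).length ≤ ℓ - 1 then vset (P i)
    else {x | x ∈ (P i).support.take (ℓ / 2 - 1)} ∪
      {x | x ∈ (P i).support.reverse.take (ℓ / 2 - 1)}

/-- A long near-prism is tidy: it contains a frame (so at most one constituent path has
length at most `ℓ-1`) whose interior is anticomplete to the rest of the graph. -/
def Tidy (G : SimpleGraph V) (ℓ : ℕ) {a b : Fin 3 → V}
    (P : ∀ i : Fin 3, G.Walk (a i) (b i)) : Prop :=
  (∀ i j, (P i).length ≤ ℓ - 1 → (P j).length ≤ ℓ - 1 → i = j) ∧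
  Anticomplete G (frameStar ℓ P) {x | x ∉ prismSupport P}

/-- The index of the first neighbour of `x` in the list `l`. -/
noncomputable def firstNbrIdx (G : SimpleGraph V) (l : List V) (x : V) : ℕ :=
  l.findIdx (fun y => decide (G.Adj x y))

/-- `α(x)`: the neighbour of `x` on `P` nearest to the first end of `P`. -/
noncomputable def alpha (G : SimpleGraph V) {u w : V} (P : G.Walk u w) (x : V) : V :=
  P.support.getD (firstNbrIdx G P.support x) u

/-- `β(x)`: the neighbour of `x` on `P` nearest to the last end of `P`. -/
noncomputable def beta (G : SimpleGraph V) {u w : V} (P : G.Walk u w) (x : V) : V :=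
  P.support.reverse.getD (firstNbrIdx G P.support.reverse x) w

/-- `A(x)`: the vertex set of the subpath of `P` from its first end to `α(x)` if `x` has
a neighbour on `P`, and all of `V(P)` otherwise. -/
noncomputable def Aset (G : SimpleGraph V) {u w : V} (P : G.Walk u w) (x : V) : Set V :=
  if ∃ y ∈ P.support, G.Adj x y then
    {z | z ∈ P.support.take (firstNbrIdx G P.support x + 1)}
  else vset P

noncomputable def A123 (G : SimpleGraph V) {a b : Fin 3 → V}
    (P : ∀ i : Fin 3, G.Walk (a i) (b i)) (x : V) : Set V :=
  ⋃ i, Aset G (P i) x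

/-- The index of `v` in the list `l`. -/
noncomputable def listIdx (l : List V) (v : V) : ℕ :=
  l.findIdx (fun z => decide (z = v))

/-- `K^m_n(v)`: the union of the maximal subpath of `P` from `v` towards the first end of
`P` of length at most `m` with no internal vertex in `Fs`, and the maximal subpath of `P`
from `v` towards the last end of `P` of length at most `n` with no internal vertex in `Fs`. -/
noncomputable def Kmn (G : SimpleGraph V) (Fs : Set V) {u w : V}
    (P : G.Walk u w) (v : V) (m n : ℕ) : Set V :=
  let t := listIdx P.support v
  {z | ∃ r, r ≤ t ∧ t - r ≤ m ∧
      (∀ q, r < q → q < t → P.support.getD q v ∉ Fs) ∧ z = P.support.getD r v} ∪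
  {z | ∃ r, t ≤ r ∧ r < P.support.length ∧ r - t ≤ n ∧
      (∀ q, t < q → q < r → P.support.getD q v ∉ Fs) ∧ z = P.support.getD r v}

/-- `y` is distant from `x` (both `K`-major), for a tidy near-prism. -/
def Distant (G : SimpleGraph V) (ℓ : ℕ) {a b : Fin 3 → V}
    (P : ∀ i : Fin 3, G.Walk (a i) (b i)) (x y : V) : Prop :=
  ¬ G.Adj x y ∧
  (∃ z ∈ A123 G P x, G.Adj y z) ∧
  (∀ i, (∃ z ∈ (P i).support, G.Adj x z) →
    ∀ z ∈ Kmn G (frameStar ℓ P) (P i) (alpha G (P i) x) (ℓ - 2) 1, ¬ G.Adj y z) ∧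
  (∀ i, (¬ ∃ z ∈ (P i).support, G.Adj x z) →
    ∃ j, j ≠ i ∧
      ∀ z ∈ Kmn G (frameStar ℓ P) (P j) (beta G (P j) x) 0 (ℓ - 3), ¬ G.Adj y z)

/-- The hole `c`, regarded as a graph on `V`. -/
def holeGraph (G : SimpleGraph V) {u : V} (c : G.Walk u u) : SimpleGraph V :=
  SimpleGraph.fromEdgeSet {e | e ∈ c.edges}

/-- The distance between two vertices in the hole `c`. -/
noncomputable def holeDist (G : SimpleGraph V) {u : V} (c : G.Walk u u) (x y : V) : ℕ :=
  (holeGraph G c).dist x y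

/-- `x` is `C`-major for the hole `c`: `x` is not on `c` and no path of `c` with at most
three vertices contains all neighbours of `x` on `c`. -/
def CMajor (G : SimpleGraph V) {u : V} (c : G.Walk u u) (x : V) : Prop :=
  x ∉ c.support ∧
  ¬ ∃ q ∈ c.support, ∀ z ∈ c.support, G.Adj x z → z = q ∨ s(q, z) ∈ c.edges

/-- A shortest long even hole. -/
def ShortestLEH (G : SimpleGraph V) (ℓ : ℕ) {u : V} (c : G.Walk u u) : Prop :=
  IsLongEvenHole ℓ c ∧
  ∀ (v : V) (c' : G.Walk v v), IsLongEvenHole ℓ c' → c.length ≤ c'.length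

/-- `L₁, L₂` are the two `x y`-paths of the hole `c`. -/
def ArcPair {G : SimpleGraph V} {u : V} (c : G.Walk u u) {x y : V}
    (L₁ L₂ : G.Walk x y) : Prop :=
  L₁.IsPath ∧ L₂.IsPath ∧
  (∀ e ∈ L₁.edges, e ∈ c.edges) ∧ (∀ e ∈ L₂.edges, e ∈ c.edges) ∧
  (∀ e ∈ c.edges, e ∈ L₁.edges ∨ e ∈ L₂.edges) ∧
  (∀ e ∈ L₁.edges, e ∉ L₂.edges)

/-- `X` is lighter than `Y`, with respect to the linear order on edges given by `idx`. -/
def Lighter [DecidableEq V] (idx : Sym2 V → ℕ) (X Y : Finset (Sym2 V)) : Prop :=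
  X.card < Y.card ∨
  (X.card = Y.card ∧ ∃ e ∈ Y, e ∉ X ∧
    ∀ f : Sym2 V, ((f ∈ X ∧ f ∉ Y) ∨ (f ∈ Y ∧ f ∉ X)) → idx e ≤ idx f)

/-- The lightest long even hole. -/
def LightestLEH [DecidableEq V] (G : SimpleGraph V) (ℓ : ℕ) (idx : Sym2 V → ℕ)
    {u : V} (c : G.Walk u u) : Prop :=
  IsLongEvenHole ℓ c ∧
  ∀ (v : V) (c' : G.Walk v v), IsLongEvenHole ℓ c' →
    c'.edges.toFinset ≠ c.edges.toFinset →
    Lighter idx c.edges.toFinset c'.edges.toFinset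

/-- A `(C,x)`-gap: a path of the hole `c` of length at least two whose ends are adjacent
to `x` and none of whose interior vertices is adjacent to `x`. -/
def IsGap (G : SimpleGraph V) {u : V} (c : G.Walk u u) (x : V) {p₁ p₂ : V}
    (P : G.Walk p₁ p₂) : Prop :=
  P.IsPath ∧ (∀ e ∈ P.edges, e ∈ c.edges) ∧ 2 ≤ P.length ∧
  G.Adj x p₁ ∧ G.Adj x p₂ ∧ ∀ z ∈ inter P, ¬ G.Adj x z

end LEH

open LEH

theorem exists_least_le {p : ℕ → Prop} {n t : ℕ} (ht : t ≤ n) (hp : p t) :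
    ∃ m, m ≤ n ∧ p m ∧ ∀ s, s < m → ¬ p s := by
  classical
  have hex : ∃ m, p m := ⟨t, hp⟩
  exact ⟨Nat.find hex, (Nat.find_min' hex hp).trans ht, Nat.find_spec hex,
    fun s hs => Nat.find_min hex hs⟩

theorem exists_greatest_le {p : ℕ → Prop} {n t : ℕ} (ht : t ≤ n) (hp : p t) :
    ∃ m, m ≤ n ∧ p m ∧ ∀ s, s ≤ n → m < s → ¬ p s := by
  classical
  exact ⟨Nat.findGreatest p n, Nat.findGreatest_le n, Nat.findGreatest_spec ht hp,
    fun s hs hms => Nat.findGreatest_is_greatest hms hs⟩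

/-- The terms `f 0, …, f n` are distinct and are consecutive vertices of an induced path. -/
def InducedSeq {V : Type*} (G : SimpleGraph V) (f : ℕ → V) (n : ℕ) : Prop :=
  ∀ s t, s ≤ n → t ≤ n →
    (f s = f t → s = t) ∧ (G.Adj (f s) (f t) ↔ s + 1 = t ∨ t + 1 = s)

/-- There is an induced path from `u` to `v` of length `n` with vertex set `S`. -/
def InducedPathOn {V : Type*} (G : SimpleGraph V) (u v : V) (S : Set V) (n : ℕ) : Prop :=
  ∃ Q : G.Walk u v, IsInducedPath Q ∧ Q.length = n ∧ vset Q = S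

/-- `u` and `v` are joined by a walk inside `T`. -/
def JoinedInside {V : Type*} (G : SimpleGraph V) (T : Set V) (u v : V) : Prop :=
  ∃ W : G.Walk u v, ∀ x ∈ W.support, x ∈ T

namespace InducedPathOn

variable {V : Type*} {G : SimpleGraph V} {u v w : V} {S T : Set V} {m n : ℕ}

theorem left_mem (h : InducedPathOn G u v S n) : u ∈ S := by
  obtain ⟨Q, -, -, rfl⟩ := h
  exact Q.start_mem_support

theorem right_mem (h : InducedPathOn G u v S n) : v ∈ S := by
  obtain ⟨Q, -, -, rfl⟩ := h
  exact Q.end_mem_support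

theorem symm (h : InducedPathOn G u v S n) : InducedPathOn G v u S n := by
  obtain ⟨Q, ⟨hp, hi⟩, hl, hs⟩ := h
  refine ⟨Q.reverse, ⟨hp.reverse, ?_⟩, by simpa using hl, ?_⟩
  · intro x hx y hy hxy
    simp only [Walk.support_reverse, List.mem_reverse] at hx hy
    simpa using hi x hx y hy hxy
  · rw [← hs]
    ext x
    simp [vset]

theorem nil (u : V) : InducedPathOn G u u {u} 0 := by
  refine ⟨Walk.nil, ⟨by simp, ?_⟩, rfl, ?_⟩
  · intro x hx y hy hxy
    simp only [Walk.support_nil, List.mem_singleton] at hx hy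
    subst hx hy
    exact (G.irrefl hxy).elim
  · ext x
    simp [vset]

theorem edge (h : G.Adj u v) : InducedPathOn G u v {u, v} 1 := by
  refine ⟨Walk.cons h Walk.nil, ⟨by simp [h.ne], ?_⟩, rfl, ?_⟩
  · intro x hx y hy hxy
    simp only [Walk.support_cons, Walk.support_nil, List.mem_cons, List.not_mem_nil,
      or_false] at hx hy
    rcases hx with rfl | rfl <;> rcases hy with rfl | rfl <;>
      simp_all [Sym2.eq_swap]
  · ext x
    simp [vset]

theorem append (h₁ : InducedPathOn G u v S m) (h₂ : InducedPathOn G v w T n)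
    (h : ∀ x ∈ S, ∀ y ∈ T, (x = y ∨ G.Adj x y) → x = v ∨ y = v) :
    InducedPathOn G u w (S ∪ T) (m + n) := by
  obtain ⟨Q, ⟨hQ, hQi⟩, rfl, rfl⟩ := h₁
  obtain ⟨R, ⟨hR, hRi⟩, rfl, rfl⟩ := h₂
  have hmix : ∀ x ∈ Q.support, ∀ y ∈ R.support, G.Adj x y →
      s(x, y) ∈ Q.edges ∨ s(x, y) ∈ R.edges := by
    intro x hx y hy hxy
    rcases h x hx y hy (Or.inr hxy) with rfl | rfl
    · exact Or.inr (hRi _ R.start_mem_support _ hy hxy)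
    · exact Or.inl (hQi _ hx _ Q.end_mem_support hxy)
  refine ⟨Q.append R, ⟨?_, ?_⟩, by simp, ?_⟩
  · rw [Walk.isPath_def, Walk.support_append]
    have hR' := hR.support_nodup
    rw [← Walk.cons_tail_support, List.nodup_cons] at hR'
    refine List.nodup_append.2 ⟨hQ.support_nodup, hR'.2, ?_⟩
    rintro x hx y hy rfl
    have hy' : x ∈ R.support := List.mem_of_mem_tail hy
    rcases h x hx x hy' (Or.inl rfl) with rfl | rfl <;> exact hR'.1 hy
  · intro x hx y hy hxy
    rw [Walk.mem_support_append_iff] at hx hy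
    rw [Walk.edges_append, List.mem_append]
    rcases hx with hx | hx <;> rcases hy with hy | hy
    · exact Or.inl (hQi _ hx _ hy hxy)
    · exact hmix _ hx _ hy hxy
    · rw [Sym2.eq_swap]
      exact hmix _ hy _ hx hxy.symm
    · exact Or.inr (hRi _ hx _ hy hxy)
  · ext x
    simp [vset, Walk.mem_support_append_iff]

theorem cons (huv : G.Adj u v) (h₂ : InducedPathOn G v w T n)
    (h : ∀ y ∈ T, u ≠ y ∧ (G.Adj u y → y = v)) :
    InducedPathOn G u w (insert u T) (n + 1) := by
  have := (edge huv).append h₂ (by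
    rintro x (rfl | rfl) y hy hxy
    · exact Or.inr ((h y hy).2 (hxy.resolve_left (h y hy).1))
    · exact Or.inl rfl)
  rw [Nat.add_comm]
  convert this using 1
  ext x
  simp only [Set.mem_insert_iff, Set.mem_union, Set.mem_singleton_iff]
  have := h₂.left_mem
  constructor
  · tauto
  · rintro ((h | rfl) | h) <;> tauto

theorem of_seq {f : ℕ → V} {N : ℕ} (hf : InducedSeq G f N) {a b : ℕ} (hab : a ≤ b) (hb : b ≤ N) :
    InducedPathOn G (f a) (f b) {v | ∃ t, a ≤ t ∧ t ≤ b ∧ v = f t} (b - a) := by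
  induction b, hab using Nat.le_induction with
  | base =>
    convert nil (G := G) (f a) using 1
    · ext v
      constructor
      · rintro ⟨t, h1, h2, rfl⟩
        rw [le_antisymm h2 h1]; rfl
      · rintro rfl
        exact ⟨a, le_rfl, le_rfl, rfl⟩
    · simp
  | succ b hab ih =>
    have := (ih (by omega)).append (edge ((hf b (b+1) (by omega) hb).2.2 (Or.inl rfl))) (by
      rintro _ ⟨t, h1, h2, rfl⟩ y (rfl | rfl) hxy
      · exact Or.inr rfl
      · left
        rcases hxy with hxy | hxy
        · have := (hf t (b+1) (by omega) hb).1 hxy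
          omega
        · have := (hf t (b+1) (by omega) hb).2.1 hxy
          have : t = b := by omega
          rw [this])
    convert this using 1
    · ext v
      constructor
      · rintro ⟨t, h1, h2, rfl⟩
        rcases Nat.lt_or_ge b t with h | h
        · have : t = b + 1 := by omega
          right; right; rw [this]; rfl
        · exact Or.inl ⟨t, h1, h, rfl⟩
      · rintro (⟨t, h1, h2, rfl⟩ | rfl | rfl)
        · exact ⟨t, h1, by omega, rfl⟩
        · exact ⟨b, by omega, by omega, rfl⟩
        · exact ⟨b+1, by omega, le_rfl, rfl⟩
    · omega

end InducedPathOn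

theorem LEH.IsInducedPath.inducedSeq {V : Type*} {G : SimpleGraph V} {u v : V} {Q : G.Walk u v}
    (h : IsInducedPath Q) : InducedSeq G Q.getVert Q.length := by
  obtain ⟨hQ, hQi⟩ := h
  have hinj : ∀ s t, s ≤ Q.length → t ≤ Q.length → Q.getVert s = Q.getVert t → s = t :=
    fun s t hs ht h => hQ.getVert_injOn hs ht h
  intro s t hs ht
  refine ⟨hinj s t hs ht, ?_, ?_⟩
  · intro hadj
    have := hQi _ (Q.getVert_mem_support s) _ (Q.getVert_mem_support t) hadj
    rw [← Walk.adj_toSubgraph_iff_mem_edges, Walk.toSubgraph_adj_iff] at this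
    obtain ⟨i, hi, hil⟩ := this
    rw [Sym2.eq_iff] at hi
    rcases hi with ⟨h1, h2⟩ | ⟨h1, h2⟩
    · have := hinj _ _ (by omega) hs h1
      have := hinj _ _ (by omega) ht h2
      omega
    · have := hinj _ _ (by omega) ht h1
      have := hinj _ _ (by omega) hs h2
      omega
  · rintro (rfl | rfl)
    · exact Q.adj_getVert_succ (by omega)
    · exact (Q.adj_getVert_succ (by omega)).symm

theorem mem_vset_iff {V : Type*} {G : SimpleGraph V} {u v : V} (Q : G.Walk u v) (x : V) :
    x ∈ vset Q ↔ ∃ t, t ≤ Q.length ∧ x = Q.getVert t := by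
  unfold vset
  rw [Set.mem_ofPred_eq, Walk.mem_support_iff_exists_getVert]
  exact ⟨fun ⟨t, h, h'⟩ => ⟨t, h', h.symm⟩, fun ⟨t, h, h'⟩ => ⟨t, h'.symm, h⟩⟩

theorem InducedPathOn.exists_seq {V : Type*} {G : SimpleGraph V} {u v : V} {S : Set V} {n : ℕ}
    (h : InducedPathOn G u v S n) : ∃ f : ℕ → V, InducedSeq G f n ∧ f 0 = u ∧ f n = v ∧
      ∀ x, x ∈ S ↔ ∃ t, t ≤ n ∧ x = f t := by
  obtain ⟨Q, hQ, rfl, rfl⟩ := h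
  exact ⟨Q.getVert, hQ.inducedSeq, Q.getVert_zero, Q.getVert_length, mem_vset_iff Q⟩

namespace JoinedInside

variable {V : Type*} {G : SimpleGraph V} {u v w : V} {S T : Set V}

theorem refl (h : u ∈ T) : JoinedInside G T u u := ⟨Walk.nil, by simpa using h⟩

theorem symm (h : JoinedInside G T u v) : JoinedInside G T v u := by
  obtain ⟨W, hW⟩ := h
  exact ⟨W.reverse, by simpa using hW⟩

theorem trans (h : JoinedInside G T u v) (h' : JoinedInside G T v w) : JoinedInside G T u w := by
  obtain ⟨W, hW⟩ := h
  obtain ⟨W', hW'⟩ := h'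
  refine ⟨W.append W', fun x hx => ?_⟩
  rw [Walk.mem_support_append_iff] at hx
  exact hx.elim (hW x) (hW' x)

theorem of_adj (hu : u ∈ T) (hv : v ∈ T) (h : G.Adj u v) : JoinedInside G T u v :=
  ⟨Walk.cons h Walk.nil, by simp [hu, hv]⟩

theorem mono (h : JoinedInside G S u v) (hST : S ⊆ T) : JoinedInside G T u v := by
  obtain ⟨W, hW⟩ := h
  exact ⟨W, fun x hx => hST (hW x hx)⟩

theorem of_seq {f : ℕ → V} {a b : ℕ} (hab : a ≤ b)
    (hadj : ∀ t, a ≤ t → t < b → G.Adj (f t) (f (t + 1))) (hT : ∀ t, a ≤ t → t ≤ b → f t ∈ T) :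
    JoinedInside G T (f a) (f b) := by
  induction b, hab using Nat.le_induction with
  | base => exact refl (hT a le_rfl le_rfl)
  | succ b hab ih =>
    exact (ih (fun t h1 h2 => hadj t h1 (by omega)) (fun t h1 h2 => hT t h1 (by omega))).trans
      (of_adj (hT _ (by omega) (by omega)) (hT _ (by omega) (by omega)) (hadj b hab (by omega)))

theorem exists_inducedPathOn (h : JoinedInside G T u v) :
    ∃ S n, InducedPathOn G u v S n ∧ S ⊆ T := by
  classical
  obtain ⟨W, hW⟩ := h
  induction W with
  | nil => exact ⟨_, _, InducedPathOn.nil _, by simpa using hW⟩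
  | @cons u v w huv W ih =>
    obtain ⟨S, n, hS, hST⟩ := ih (fun x hx => hW x (by simp [hx]))
    have huT : u ∈ T := hW u (by simp)
    obtain ⟨f, hf, hf0, hfn, hfS⟩ := hS.exists_seq
    have hsub : ∀ t, {y | ∃ s, t ≤ s ∧ s ≤ n ∧ y = f s} ⊆ T := by
      rintro t _ ⟨s, -, hs, rfl⟩
      exact hST ((hfS _).2 ⟨s, hs, rfl⟩)
    by_cases hu : u ∈ S
    · obtain ⟨t, ht, rfl⟩ := (hfS u).1 hu
      refine ⟨_, _, hfn ▸ InducedPathOn.of_seq hf ht le_rfl, hsub t⟩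
    · obtain ⟨t, htn, hadj, hmax⟩ := exists_greatest_le (p := fun t => G.Adj u (f t))
        (Nat.zero_le n) (hf0 ▸ huv)
      subst hfn
      refine ⟨_, _, InducedPathOn.cons hadj (InducedPathOn.of_seq hf htn le_rfl) ?_, ?_⟩
      · rintro _ ⟨s, hs, hsn, rfl⟩
        refine ⟨fun h => hu ((hfS _).2 ⟨s, hsn, h⟩), fun h => ?_⟩
        by_contra hne
        exact hmax s hsn (lt_of_le_of_ne hs fun h => hne (by rw [h])) h
      · rintro y (rfl | hy)
        · exact huT
        · exact hsub _ hy

end JoinedInside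

section Builders

variable {V : Type*} {G : SimpleGraph V} {ℓ : ℕ}

theorem hasLongTheta_of_inducedPathOn {u v : V} {S₁ S₂ S₃ : Set V} {n₁ n₂ n₃ : ℕ}
    (hne : u ≠ v) (hadj : ¬ G.Adj u v)
    (h₁ : InducedPathOn G u v S₁ n₁) (h₂ : InducedPathOn G u v S₂ n₂)
    (h₃ : InducedPathOn G u v S₃ n₃)
    (h₁₂ : ∀ x ∈ S₁, ∀ y ∈ S₂, (x = y ∨ G.Adj x y) → x = u ∨ x = v ∨ y = u ∨ y = v)
    (h₁₃ : ∀ x ∈ S₁, ∀ y ∈ S₃, (x = y ∨ G.Adj x y) → x = u ∨ x = v ∨ y = u ∨ y = v)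
    (h₂₃ : ∀ x ∈ S₂, ∀ y ∈ S₃, (x = y ∨ G.Adj x y) → x = u ∨ x = v ∨ y = u ∨ y = v)
    (hl₁₂ : ℓ ≤ n₁ + n₂) (hl₁₃ : ℓ ≤ n₁ + n₃) (hl₂₃ : ℓ ≤ n₂ + n₃) : HasLongTheta G ℓ := by
  obtain ⟨Q₁, hQ₁, rfl, rfl⟩ := h₁
  obtain ⟨Q₂, hQ₂, rfl, rfl⟩ := h₂
  obtain ⟨Q₃, hQ₃, rfl, rfl⟩ := h₃
  have key : ∀ {Q Q' : G.Walk u v},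
      (∀ x ∈ vset Q, ∀ y ∈ vset Q', (x = y ∨ G.Adj x y) → x = u ∨ x = v ∨ y = u ∨ y = v) →
      Anticomplete G (inter Q) (inter Q') := by
    rintro Q Q' h x ⟨hx, hxu, hxv⟩ y ⟨hy, hyu, hyv⟩
    have := h x hx y hy
    tauto
  exact ⟨u, v, Q₁, Q₂, Q₃, hne, hadj, hQ₁, hQ₂, hQ₃, key h₁₂, key h₁₃, key h₂₃, hl₁₂, hl₁₃, hl₂₃⟩

/-- Two vertex sets meet the way the constituent paths of a near-prism do: they are disjoint,
and the only edges between them join `a` to `a'` and `b` to `b'`. -/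
def PrismLinked (G : SimpleGraph V) (a b : V) (S : Set V) (a' b' : V) (S' : Set V) : Prop :=
  ∀ x ∈ S, ∀ y ∈ S', x ≠ y ∧ (G.Adj x y → x = a ∧ y = a' ∨ x = b ∧ y = b')

theorem PrismLinked.symm {a b a' b' : V} {S S' : Set V} (h : PrismLinked G a b S a' b' S') :
    PrismLinked G a' b' S' a b S := by
  intro x hx y hy
  have := h y hy x hx
  refine ⟨this.1.symm, fun hxy => ?_⟩
  have := this.2 hxy.symm
  tauto

theorem PrismLinked.isLongHoleOn {a b a' b' : V} {S S' : Set V} {n n' : ℕ}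
    (hc : PrismLinked G a b S a' b' S') (hℓ : 4 ≤ ℓ)
    (h : InducedPathOn G a b S n) (h' : InducedPathOn G a' b' S' n')
    (ha : G.Adj a a') (hb : G.Adj b b') (hab : ¬ (a = b ∧ a' = b')) (hl : ℓ ≤ n + n' + 2) :
    IsLongHoleOn G ℓ (S ∪ S') := by
  obtain ⟨Q, ⟨hQ, hQi⟩, rfl, rfl⟩ := h
  obtain ⟨R, ⟨hR, hRi⟩, rfl, rfl⟩ := h'
  have hmem : ∀ x, x ∈ (Walk.cons ha.symm (Q.append (Walk.cons hb R.reverse))).support ↔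
      x ∈ Q.support ∨ x ∈ R.support := by
    intro x
    simp only [Walk.support_cons, List.mem_cons, Walk.mem_support_append_iff,
      Walk.support_reverse, List.mem_reverse]
    have := R.start_mem_support
    have := Q.end_mem_support
    constructor
    · rintro (rfl | h | rfl | h) <;> tauto
    · tauto
  have hmix : ∀ x ∈ Q.support, ∀ y ∈ R.support, G.Adj x y →
      s(x, y) ∈ (Walk.cons ha.symm (Q.append (Walk.cons hb R.reverse))).edges := by
    intro x hx y hy hxy
    rcases (hc x hx y hy).2 hxy with ⟨rfl, rfl⟩ | ⟨rfl, rfl⟩ <;>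
      simp [Walk.edges_cons, Walk.edges_append]
  refine ⟨a', Walk.cons ha.symm (Q.append (Walk.cons hb R.reverse)), ⟨?_, ?_, ?_⟩, ?_, ?_⟩
  · rw [Walk.cons_isCycle_iff]
    constructor
    · rw [Walk.isPath_def, Walk.support_append]
      refine List.nodup_append.2 ⟨hQ.support_nodup, ?_, ?_⟩
      · simpa using hR.support_nodup
      · intro x hx y hy
        simp only [Walk.support_cons, List.tail_cons, Walk.support_reverse,
          List.mem_reverse] at hy
        exact (hc x hx y hy).1
    · simp only [Walk.edges_append, Walk.edges_cons, List.mem_append, List.mem_cons,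
        Walk.edges_reverse, List.mem_reverse, not_or]
      refine ⟨fun h => ?_, fun h => ?_, fun h => ?_⟩
      · exact (hc _ (Walk.fst_mem_support_of_mem_edges _ h) _ R.start_mem_support).1 rfl
      · rcases Sym2.eq_iff.1 h with ⟨h1, h2⟩ | ⟨h1, h2⟩
        · exact (hc _ Q.end_mem_support _ R.start_mem_support).1 h1.symm
        · exact hab ⟨h2, h1⟩
      · exact (hc _ Q.start_mem_support _ (Walk.snd_mem_support_of_mem_edges _ h)).1 rfl
  · simp only [Walk.length_cons, Walk.length_append, Walk.length_reverse]
    omega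
  · intro x hx y hy hxy
    rw [hmem] at hx hy
    rcases hx with hx | hx <;> rcases hy with hy | hy
    · have := hQi x hx y hy hxy
      simp [Walk.edges_cons, Walk.edges_append, this]
    · exact hmix x hx y hy hxy
    · rw [Sym2.eq_swap]
      exact hmix y hy x hx hxy.symm
    · have := hRi x hx y hy hxy
      simp [Walk.edges_cons, Walk.edges_append, this]
  · simp only [Walk.length_cons, Walk.length_append, Walk.length_reverse]
    omega
  · ext x
    exact hmem x

theorem ncard_vset_le {u v : V} (Q : G.Walk u v) : (vset Q).ncard ≤ Q.length + 1 := by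
  classical
  have : vset Q = (Q.support.toFinset : Set V) := by
    ext x
    simp [vset]
  rw [this, Set.ncard_coe_finset, ← Walk.length_support]
  exact List.toFinset_card_le _

theorem exists_isLongNearPrism (hℓ : 4 ≤ ℓ) {a b : Fin 3 → V} {S : Fin 3 → Set V} {n : Fin 3 → ℕ}
    (h : ∀ i, InducedPathOn G (a i) (b i) (S i) (n i))
    (ha : ∀ i j, i ≠ j → G.Adj (a i) (a j)) (hb : ∀ i j, i ≠ j → G.Adj (b i) (b j))
    (hab : (Set.range a ∩ Set.range b).Subsingleton)
    (hc : ∀ i j, i ≠ j → PrismLinked G (a i) (b i) (S i) (a j) (b j) (S j))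
    (hl : ∀ i j, i ≠ j → ℓ ≤ n i + n j + 2) :
    ∃ P : ∀ i, G.Walk (a i) (b i), IsLongNearPrism ℓ a b P ∧
      (prismSupport P).ncard ≤ n 0 + n 1 + n 2 + 3 := by
  choose P hP hPn hPS using h
  refine ⟨P, ⟨ha, hb, hab, fun i => (hP i).1, ?_, ?_⟩, ?_⟩
  · intro i j hij x hx hx'
    exact (hc i j hij x ((hPS i).subset hx) x ((hPS j).subset hx')).1 rfl
  · intro i j hij
    rw [hPS, hPS]
    refine (hc i j hij).isLongHoleOn hℓ ⟨P i, hP i, hPn i, hPS i⟩ ⟨P j, hP j, hPn j, hPS j⟩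
      (ha i j hij) (hb i j hij) ?_ (hl i j hij)
    rintro ⟨h1, h2⟩
    exact (ha i j hij).ne (hab ⟨⟨i, rfl⟩, ⟨i, h1.symm⟩⟩ ⟨⟨j, rfl⟩, ⟨j, h2.symm⟩⟩)
  · have : prismSupport P = vset (P 0) ∪ vset (P 1) ∪ vset (P 2) := by
      ext x
      simp [prismSupport, Fin.exists_fin_succ, or_assoc]
    rw [this]
    have h1 := Set.ncard_union_le (vset (P 0) ∪ vset (P 1)) (vset (P 2))
    have h2 := Set.ncard_union_le (vset (P 0)) (vset (P 1))
    have := ncard_vset_le (P 0)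
    have := ncard_vset_le (P 1)
    have := ncard_vset_le (P 2)
    rw [hPn] at *
    omega

end Builders

/-- Coordinates on a tidy shortest long near-prism: `p i 0, …, p i (n i)` are the vertices of its
`i`-th constituent path in order, and `2 * h` bounds the length of long holes from below. -/
structure PrismCoords {V : Type*} (G : SimpleGraph V) (h : ℕ) (p : Fin 3 → ℕ → V)
    (n : Fin 3 → ℕ) : Prop where
  seq : ∀ i, InducedSeq G (p i) (n i)
  ne : ∀ i j, i ≠ j → ∀ s t, s ≤ n i → t ≤ n j → p i s ≠ p j t
  adj_iff : ∀ i j, i ≠ j → ∀ s t, s ≤ n i → t ≤ n j →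
    (G.Adj (p i s) (p j t) ↔ s = 0 ∧ t = 0 ∨ s = n i ∧ t = n j)
  long : ∀ i j, i ≠ j → 2 * h ≤ n i + n j + 2
  stub : ∀ w, (∀ i t, t ≤ n i → w ≠ p i t) → ∀ i t, t ≤ n i → G.Adj w (p i t) →
    2 * h ≤ n i ∧ h - 1 ≤ t ∧ t + (h - 1) ≤ n i
  shortest : ∀ (a b : Fin 3 → V) (S : Fin 3 → Set V) (m : Fin 3 → ℕ),
    (∀ i, InducedPathOn G (a i) (b i) (S i) (m i)) →
    (∀ i j, i ≠ j → G.Adj (a i) (a j)) → (∀ i j, i ≠ j → G.Adj (b i) (b j)) →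
    (Set.range a ∩ Set.range b).Subsingleton →
    (∀ i j, i ≠ j → PrismLinked G (a i) (b i) (S i) (a j) (b j) (S j)) →
    (∀ i j, i ≠ j → 2 * h ≤ m i + m j + 2) → n 0 + n 1 + n 2 ≤ m 0 + m 1 + m 2

section PrismFacts

variable {V : Type*} {G : SimpleGraph V} {ℓ : ℕ}

theorem LEH.IsLongHoleOn.eq_of_adj {S : Set V} (hS : IsLongHoleOn G ℓ S) {x y₁ y₂ y₃ : V}
    (hx : x ∈ S) (h₁ : y₁ ∈ S) (h₂ : y₂ ∈ S) (h₃ : y₃ ∈ S)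
    (a₁ : G.Adj x y₁) (a₂ : G.Adj x y₂) (a₃ : G.Adj x y₃) : y₁ = y₂ ∨ y₁ = y₃ ∨ y₂ = y₃ := by
  obtain ⟨u, c, ⟨hc, -, hind⟩, -, rfl⟩ := hS
  have hcard := hc.ncard_neighborSet_toSubgraph_eq_two hx
  have hsub : ∀ y ∈ c.support, G.Adj x y → y ∈ c.toSubgraph.neighborSet x := by
    intro y hy hxy
    rw [Subgraph.mem_neighborSet, Walk.adj_toSubgraph_iff_mem_edges]
    exact hind x hx y hy hxy
  obtain ⟨z, z', -, hz⟩ := Set.ncard_eq_two.1 hcard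
  have e₁ := hsub _ h₁ a₁
  have e₂ := hsub _ h₂ a₂
  have e₃ := hsub _ h₃ a₃
  rw [hz] at e₁ e₂ e₃
  simp only [Set.mem_insert_iff, Set.mem_singleton_iff] at e₁ e₂ e₃
  rcases e₁ with rfl | rfl <;> rcases e₂ with rfl | rfl <;> rcases e₃ with rfl | rfl <;> simp

theorem LEH.IsLongHoleOn.le_ncard {S : Set V} (hfin : S.Finite) (hS : IsLongHoleOn G ℓ S) :
    ℓ ≤ S.ncard := by
  classical
  obtain ⟨u, c, ⟨hc, -, -⟩, hl, rfl⟩ := hS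
  have h1 : c.support.tail.toFinset.card = c.length := by
    rw [List.toFinset_card_of_nodup hc.support_nodup]
    simp
  have h2 : (c.support.tail.toFinset : Set V).ncard ≤ {x | x ∈ c.support}.ncard := by
    refine Set.ncard_le_ncard ?_ hfin
    intro x hx
    simp only [List.coe_toFinset, Set.mem_ofPred_eq] at hx
    exact List.mem_of_mem_tail hx
  rw [Set.ncard_coe_finset, h1] at h2
  omega

theorem finite_vset {u v : V} (Q : G.Walk u v) : (vset Q).Finite :=
  List.finite_toSet Q.support

variable {a b : Fin 3 → V} {P : ∀ i : Fin 3, G.Walk (a i) (b i)}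

theorem getVert_mem_vset {u v : V} (Q : G.Walk u v) (t : ℕ) : Q.getVert t ∈ vset Q :=
  Q.getVert_mem_support t

theorem LEH.IsLongNearPrism.getVert_ne (hK : IsLongNearPrism ℓ a b P) {i j : Fin 3} (hij : i ≠ j)
    (s t : ℕ) : (P i).getVert s ≠ (P j).getVert t := by
  intro h
  exact hK.2.2.2.2.1 i j hij _ ((P i).getVert_mem_support s) (h ▸ (P j).getVert_mem_support t)

theorem LEH.IsLongNearPrism.le_length (hK : IsLongNearPrism ℓ a b P) {i j : Fin 3} (hij : i ≠ j) :
    ℓ ≤ (P i).length + (P j).length + 2 := by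
  have h1 := (hK.2.2.2.2.2 i j hij).le_ncard ((finite_vset _).union (finite_vset _))
  have h2 := Set.ncard_union_le (vset (P i)) (vset (P j))
  have h3 := ncard_vset_le (P i)
  have h4 := ncard_vset_le (P j)
  omega

theorem LEH.IsLongNearPrism.eq_of_adj (hK : IsLongNearPrism ℓ a b P) {i j : Fin 3} (hij : i ≠ j)
    {x y₁ y₂ y₃ : V} (hx : x ∈ vset (P i) ∪ vset (P j)) (h₁ : y₁ ∈ vset (P i) ∪ vset (P j))
    (h₂ : y₂ ∈ vset (P i) ∪ vset (P j)) (h₃ : y₃ ∈ vset (P i) ∪ vset (P j))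
    (a₁ : G.Adj x y₁) (a₂ : G.Adj x y₂) (a₃ : G.Adj x y₃) : y₁ = y₂ ∨ y₁ = y₃ ∨ y₂ = y₃ :=
  (hK.2.2.2.2.2 i j hij).eq_of_adj hx h₁ h₂ h₃ a₁ a₂ a₃

theorem LEH.IsLongNearPrism.getVert_inj (hK : IsLongNearPrism ℓ a b P) {i : Fin 3} {s t : ℕ}
    (hs : s ≤ (P i).length) (ht : t ≤ (P i).length) (h : (P i).getVert s = (P i).getVert t) :
    s = t :=
  (hK.2.2.2.1 i).getVert_injOn hs ht h

theorem LEH.IsLongNearPrism.adj_zero (hK : IsLongNearPrism ℓ a b P) {i j : Fin 3} (hij : i ≠ j) :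
    G.Adj ((P i).getVert 0) ((P j).getVert 0) := by
  simpa using hK.1 i j hij

theorem LEH.IsLongNearPrism.adj_length (hK : IsLongNearPrism ℓ a b P) {i j : Fin 3} (hij : i ≠ j) :
    G.Adj ((P i).getVert (P i).length) ((P j).getVert (P j).length) := by
  simpa using hK.2.1 i j hij

theorem LEH.IsLongNearPrism.not_adj_getVert (hK : IsLongNearPrism ℓ a b P) {i : Fin 3} {s t : ℕ}
    (hst : s + 1 < t) (ht : t ≤ (P i).length) :
    ¬ G.Adj ((P i).getVert s) ((P i).getVert t) := by
  intro hadj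
  obtain ⟨j, hj⟩ := exists_ne i
  have m : ∀ q, (P i).getVert q ∈ vset (P i) ∪ vset (P j) := fun q => Or.inl (getVert_mem_vset _ q)
  have m' : ∀ q, (P j).getVert q ∈ vset (P i) ∪ vset (P j) := fun q => Or.inr (getVert_mem_vset _ q)
  have a1 := (P i).adj_getVert_succ (show s < (P i).length by omega)
  rcases Nat.eq_zero_or_pos s with rfl | hs
  · rcases hK.eq_of_adj hj.symm (m 0) (m _) (m _) (m' 0) hadj a1 (hK.adj_zero hj.symm)
      with h | h | h
    · have := hK.getVert_inj ht (by omega) h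
      omega
    · exact hK.getVert_ne hj.symm _ _ h
    · exact hK.getVert_ne hj.symm _ _ h
  · have a2 := (P i).adj_getVert_succ (show s - 1 < (P i).length by omega)
    rw [show s - 1 + 1 = s by omega] at a2
    rcases hK.eq_of_adj hj.symm (m s) (m _) (m _) (m (s-1)) hadj a1 a2.symm with h | h | h
    · have := hK.getVert_inj ht (by omega) h
      omega
    · have := hK.getVert_inj ht (by omega) h
      omega
    · have := hK.getVert_inj (by omega) (by omega) h
      omega

theorem LEH.IsLongNearPrism.adj_getVert (hK : IsLongNearPrism ℓ a b P) (hℓ : 6 ≤ ℓ) {i j : Fin 3}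
    (hij : i ≠ j) {s t : ℕ} (hs : s ≤ (P i).length) (ht : t ≤ (P j).length)
    (hadj : G.Adj ((P i).getVert s) ((P j).getVert t)) :
    s = 0 ∧ t = 0 ∨ s = (P i).length ∧ t = (P j).length := by
  have m : ∀ q, (P i).getVert q ∈ vset (P i) ∪ vset (P j) := fun q => Or.inl (getVert_mem_vset _ q)
  have m' : ∀ q, (P j).getVert q ∈ vset (P i) ∪ vset (P j) := fun q => Or.inr (getVert_mem_vset _ q)
  have hl := hK.le_length hij
  rcases Nat.eq_zero_or_pos s with rfl | hs0
  · rcases Nat.eq_zero_or_pos (P i).length with hn | hn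
    · have a1 := hK.adj_length hij
      rw [hn] at a1
      rcases hK.eq_of_adj hij (m 0) (m' _) (m' _) (m' _) hadj a1 (hK.adj_zero hij) with h | h | h
      · have := hK.getVert_inj ht le_rfl h
        omega
      · have := hK.getVert_inj ht (Nat.zero_le _) h
        omega
      · have := hK.getVert_inj le_rfl (Nat.zero_le _) h
        omega
    · rcases hK.eq_of_adj hij (m 0) (m' _) (m _) (m' _) hadj ((P i).adj_getVert_succ hn)
        (hK.adj_zero hij) with h | h | h
      · exact (hK.getVert_ne hij _ _ h.symm).elim
      · have := hK.getVert_inj ht (Nat.zero_le _) h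
        omega
      · exact (hK.getVert_ne hij _ _ h).elim
  · have a2 := (P i).adj_getVert_succ (show s - 1 < (P i).length by omega)
    rw [show s - 1 + 1 = s by omega] at a2
    rcases Nat.lt_or_ge s (P i).length with hsn | hsn
    · rcases hK.eq_of_adj hij (m s) (m' _) (m _) (m _) hadj ((P i).adj_getVert_succ hsn) a2.symm
        with h | h | h
      · exact (hK.getVert_ne hij _ _ h.symm).elim
      · exact (hK.getVert_ne hij _ _ h.symm).elim
      · have := hK.getVert_inj (by omega) (by omega) h
        omega
    · have hsn' : s = (P i).length := le_antisymm hs hsn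
      subst hsn'
      rcases hK.eq_of_adj hij (m _) (m' _) (m _) (m' _) hadj a2.symm (hK.adj_length hij)
        with h | h | h
      · exact (hK.getVert_ne hij _ _ h.symm).elim
      · have := hK.getVert_inj ht le_rfl h
        omega
      · exact (hK.getVert_ne hij _ _ h).elim

theorem getVert_mem_take_support {u v : V} (Q : G.Walk u v) {t m : ℕ} (ht : t ≤ Q.length)
    (hm : t < m) : Q.getVert t ∈ Q.support.take m := by
  rw [List.mem_take_iff_getElem]
  exact ⟨t, by rw [Walk.length_support]; omega, (Q.getVert_eq_support_getElem ht).symm⟩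

theorem exists_getVert_of_mem_take_support {u v x : V} (Q : G.Walk u v) {m : ℕ}
    (hx : x ∈ Q.support.take m) : ∃ t, t < m ∧ t ≤ Q.length ∧ x = Q.getVert t := by
  rw [List.mem_take_iff_getElem] at hx
  obtain ⟨t, ht, rfl⟩ := hx
  rw [Walk.length_support] at ht
  exact ⟨t, by omega, by omega, (Q.getVert_eq_support_getElem (by omega)).symm⟩

theorem getVert_mem_frameStar {i : Fin 3} {t : ℕ} (ht : t ≤ (P i).length)
    (h : (P i).length ≤ ℓ - 1 ∨ t < ℓ / 2 - 1 ∨ (P i).length < t + (ℓ / 2 - 1)) :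
    (P i).getVert t ∈ frameStar ℓ P := by
  refine Set.mem_iUnion.2 ⟨i, ?_⟩
  split_ifs with hn
  · exact getVert_mem_vset _ _
  · rcases h with h | h | h
    · exact (hn h).elim
    · exact Or.inl (getVert_mem_take_support _ ht h)
    · right
      have := getVert_mem_take_support (P i).reverse (t := (P i).length - t) (m := ℓ / 2 - 1)
        (by simp) (by omega)
      rw [Walk.getVert_reverse, Walk.support_reverse] at this
      rwa [show (P i).length - ((P i).length - t) = t by omega] at this

theorem LEH.IsLongNearPrism.of_mem_frameStar (hK : IsLongNearPrism ℓ a b P) {i : Fin 3} {t : ℕ}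
    (ht : t ≤ (P i).length) (h : (P i).getVert t ∈ frameStar ℓ P) :
    (P i).length ≤ ℓ - 1 ∨ t < ℓ / 2 - 1 ∨ (P i).length < t + (ℓ / 2 - 1) := by
  obtain ⟨j, hj⟩ := Set.mem_iUnion.1 h
  obtain rfl : i = j := by
    by_contra hne
    have : (P i).getVert t ∈ vset (P j) := by
      split_ifs at hj
      · exact hj
      · rcases hj with hj | hj
        · exact List.mem_of_mem_take hj
        · exact List.mem_reverse.1 (List.mem_of_mem_take hj)
    exact hK.2.2.2.2.1 i j hne _ ((P i).getVert_mem_support t) this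
  split_ifs at hj with hn
  · exact Or.inl hn
  · rcases hj with hj | hj
    · obtain ⟨s, hs, hsl, hst⟩ := exists_getVert_of_mem_take_support _ hj
      have := hK.getVert_inj ht hsl hst
      omega
    · have hj' : (P i).getVert t ∈ (P i).reverse.support.take (ℓ / 2 - 1) := by
        rw [Walk.support_reverse]
        exact hj
      obtain ⟨s, hs, hsl, hst⟩ := exists_getVert_of_mem_take_support _ hj'
      rw [Walk.getVert_reverse] at hst
      have := hK.getVert_inj ht (by omega) hst
      rw [Walk.length_reverse] at hsl
      omega

theorem mem_prismSupport_iff {x : V} :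
    x ∈ prismSupport P ↔ ∃ i t, t ≤ (P i).length ∧ x = (P i).getVert t := by
  simp only [prismSupport, Set.mem_iUnion, mem_vset_iff]

theorem LEH.IsLongNearPrism.ncard_prismSupport (hK : IsLongNearPrism ℓ a b P) :
    (prismSupport P).ncard = (P 0).length + (P 1).length + (P 2).length + 3 := by
  classical
  have hcard : ∀ i, (vset (P i)).ncard = (P i).length + 1 := by
    intro i
    have : vset (P i) = ((P i).support.toFinset : Set V) := by
      ext x
      simp [vset]
    rw [this, Set.ncard_coe_finset, List.toFinset_card_of_nodup (hK.2.2.2.1 i).support_nodup,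
      Walk.length_support]
  have hdis : ∀ i j, i ≠ j → Disjoint (vset (P i)) (vset (P j)) := fun i j hij =>
    Set.disjoint_left.2 fun x hx hx' => hK.2.2.2.2.1 i j hij x hx hx'
  have : prismSupport P = vset (P 0) ∪ vset (P 1) ∪ vset (P 2) := by
    ext x
    simp [prismSupport, Fin.exists_fin_succ, or_assoc]
  rw [this, Set.ncard_union_eq _ ((finite_vset _).union (finite_vset _)) (finite_vset _),
    Set.ncard_union_eq (hdis 0 1 (by decide)) (finite_vset _) (finite_vset _), hcard, hcard, hcard]
  · ring
  · exact Set.disjoint_union_left.2 ⟨hdis 0 2 (by decide), hdis 1 2 (by decide)⟩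

theorem prismCoords {h : ℕ} (hh : 3 ≤ h) (hsh : ShortestLNP G (2 * h) P) (ht : Tidy G (2 * h) P) :
    PrismCoords G h (fun i => (P i).getVert) (fun i => (P i).length) := by
  have hK := hsh.1
  refine ⟨?_, fun i j hij s t _ _ => hK.getVert_ne hij s t, ?_, fun i j hij => hK.le_length hij,
    ?_, ?_⟩
  · intro i s t hs ht
    refine ⟨hK.getVert_inj hs ht, fun hadj => ?_, ?_⟩
    · by_contra hcon
      rcases lt_trichotomy s t with hst | rfl | hst
      · exact hK.not_adj_getVert (by omega) ht hadj
      · exact G.irrefl hadj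
      · exact hK.not_adj_getVert (by omega) hs hadj.symm
    · rintro (rfl | rfl)
      · exact (P i).adj_getVert_succ (by omega)
      · exact ((P i).adj_getVert_succ (by omega)).symm
  · intro i j hij s t hs ht
    refine ⟨hK.adj_getVert (by omega) hij hs ht, ?_⟩
    rintro (⟨rfl, rfl⟩ | ⟨rfl, rfl⟩)
    · exact hK.adj_zero hij
    · exact hK.adj_length hij
  · intro w hw i t hti hadj
    by_contra hcon
    have hF : (P i).getVert t ∈ frameStar (2 * h) P := getVert_mem_frameStar hti (by omega)
    refine (ht.2 hF (show w ∈ {x | x ∉ prismSupport P} from ?_)).2 hadj.symm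
    intro hwm
    obtain ⟨i, t, hit, rfl⟩ := mem_prismSupport_iff.1 hwm
    exact hw i t hit rfl
  · intro a' b' S m h1 h2 h3 h4 h5 h6
    obtain ⟨P', hP', hc⟩ := exists_isLongNearPrism (by omega) h1 h2 h3 h4 h5 h6
    have := hsh.2 a' b' P' hP'
    have := hK.ncard_prismSupport
    omega

end PrismFacts

section Translation

variable {V : Type*} {G : SimpleGraph V} {u v x y : V} {Q : G.Walk u v}

theorem support_getD_eq_getVert (Q : G.Walk u v) {t : ℕ} (ht : t ≤ Q.length) (d : V) :
    Q.support.getD t d = Q.getVert t := by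
  rw [List.getD_eq_getElem _ _ (by rw [Walk.length_support]; omega),
    Q.getVert_eq_support_getElem ht]

theorem firstNbrIdx_support_eq {r : ℕ} (hr : r ≤ Q.length) (hadj : G.Adj x (Q.getVert r))
    (hlt : ∀ s, s < r → ¬ G.Adj x (Q.getVert s)) : firstNbrIdx G Q.support x = r := by
  have hr' : r < Q.support.length := by rw [Walk.length_support]; omega
  rw [firstNbrIdx, List.findIdx_eq hr']
  refine ⟨?_, fun s hs => ?_⟩
  · rw [← Q.getVert_eq_support_getElem hr]
    simpa using hadj
  · rw [← Q.getVert_eq_support_getElem (by omega)]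
    simpa using hlt s hs

theorem mem_Aset_of_adj {r : ℕ} (hr : r ≤ Q.length) (hadj : G.Adj x (Q.getVert r))
    (hlt : ∀ s, s < r → ¬ G.Adj x (Q.getVert s)) (h : y ∈ Aset G Q x) :
    ∃ t, t ≤ r ∧ y = Q.getVert t := by
  rw [Aset, if_pos ⟨_, Q.getVert_mem_support r, hadj⟩, firstNbrIdx_support_eq hr hadj hlt] at h
  obtain ⟨t, ht, -, rfl⟩ := exists_getVert_of_mem_take_support _ h
  exact ⟨t, by omega, rfl⟩

theorem Aset_subset_vset : Aset G Q x ⊆ vset Q := by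
  intro y hy
  unfold Aset at hy
  split_ifs at hy
  · exact List.mem_of_mem_take hy
  · exact hy

theorem listIdx_support_getVert (hQ : Q.IsPath) {r : ℕ} (hr : r ≤ Q.length) :
    listIdx Q.support (Q.getVert r) = r := by
  have hr' : r < Q.support.length := by rw [Walk.length_support]; omega
  rw [listIdx, List.findIdx_eq hr']
  refine ⟨?_, fun s hs => ?_⟩
  · rw [← Q.getVert_eq_support_getElem hr]
    simp
  · rw [← Q.getVert_eq_support_getElem (by omega)]
    simp only [decide_eq_false_iff_not]
    intro h
    have := hQ.getVert_injOn (show s ≤ Q.length by omega) hr h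
    omega

variable {ℓ : ℕ} {a b : Fin 3 → V} {P : ∀ i : Fin 3, G.Walk (a i) (b i)}

theorem LEH.KMajor.ne_getVert (hx : KMajor G P x) {i : Fin 3} {t : ℕ} (ht : t ≤ (P i).length) :
    x ≠ (P i).getVert t :=
  fun h => hx.1 (mem_prismSupport_iff.2 ⟨i, t, ht, h⟩)

theorem prismGraph_adj_getVert {i : Fin 3} {t : ℕ} (ht : t < (P i).length) :
    (prismGraph G a b P).Adj ((P i).getVert t) ((P i).getVert (t + 1)) := by
  have h := (P i).toSubgraph_adj_getVert ht
  rw [Walk.adj_toSubgraph_iff_mem_edges] at h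
  rw [prismGraph, SimpleGraph.fromEdgeSet_adj]
  exact ⟨Or.inr ⟨i, h⟩, ((P i).adj_getVert_succ ht).ne⟩

theorem LEH.KMajor.exists_adj (hK : IsLongNearPrism ℓ a b P) (hx : KMajor G P x) (i : Fin 3)
    {c : ℕ} (hc : c ≤ (P i).length) :
    ∃ j t, t ≤ (P j).length ∧ G.Adj x ((P j).getVert t) ∧ ¬ (j = i ∧ c ≤ t ∧ t ≤ c + 2) := by
  by_contra hcon
  push Not at hcon
  have hnbr : ∀ z ∈ prismSupport P, G.Adj x z → ∃ t, c ≤ t ∧ t ≤ c + 2 ∧ t ≤ (P i).length ∧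
      z = (P i).getVert t := by
    intro z hz hadj
    obtain ⟨j, t, ht, rfl⟩ := mem_prismSupport_iff.1 hz
    obtain ⟨rfl, h1, h2⟩ := hcon j t ht hadj
    exact ⟨t, h1, h2, ht, rfl⟩
  have hne : ∀ s t, s < t → t ≤ (P i).length → (P i).getVert s ≠ (P i).getVert t := by
    intro s t hst ht h
    have := hK.getVert_inj (by omega) ht h
    omega
  apply hx.2
  by_cases h0 : (P i).length = c
  · refine ⟨_, _, (Walk.nil : (prismGraph G a b P).Walk ((P i).getVert c) _), by simp, by simp, ?_⟩
    intro z hz hadj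
    obtain ⟨t, h1, h2, h3, rfl⟩ := hnbr z hz hadj
    rw [show t = c by omega]
    simp
  by_cases h1 : (P i).length = c + 1
  · refine ⟨_, _, Walk.cons (prismGraph_adj_getVert (show c < (P i).length by omega)) Walk.nil,
      by simp [hne c (c + 1) (by omega) (by omega)], by simp, ?_⟩
    intro z hz hadj
    obtain ⟨t, h1, h2, h3, rfl⟩ := hnbr z hz hadj
    rcases (by omega : t = c ∨ t = c + 1) with rfl | rfl <;> simp
  · refine ⟨_, _, Walk.cons (prismGraph_adj_getVert (show c < (P i).length by omega))
      (Walk.cons (prismGraph_adj_getVert (show c + 1 < (P i).length by omega)) Walk.nil),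
      by simp [hne c (c + 1) (by omega) (by omega), hne c (c + 1 + 1) (by omega) (by omega),
        hne (c + 1) (c + 1 + 1) (by omega) (by omega)], by simp, ?_⟩
    intro z hz hadj
    obtain ⟨t, h1, h2, h3, rfl⟩ := hnbr z hz hadj
    rcases (by omega : t = c ∨ t = c + 1 ∨ t = c + 1 + 1) with rfl | rfl | rfl <;> simp

theorem LEH.Distant.not_adj_near {h : ℕ} (hh : 3 ≤ h) (hsh : ShortestLNP G (2 * h) P)
    (ht : Tidy G (2 * h) P) (hx : KMajor G P x) (hy : KMajor G P y) (hd : Distant G (2 * h) P x y)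
    {i : Fin 3} {r : ℕ} (hr : r ≤ (P i).length) (hadj : G.Adj x ((P i).getVert r))
    (hlt : ∀ s, s < r → ¬ G.Adj x ((P i).getVert s)) {t : ℕ} (hti : t ≤ (P i).length)
    (hyt : G.Adj y ((P i).getVert t)) : t + (2 * h - 2) < r ∨ r + 1 < t := by
  by_contra hcon
  have hC := prismCoords hh hsh ht
  have hsx := hC.stub x (fun i t ht => hx.ne_getVert ht) i r hr hadj
  have hsy := hC.stub y (fun i t ht => hy.ne_getVert ht) i t hti hyt
  have hF : ∀ q, (h - 1 ≤ q) → q + (h - 1) ≤ (P i).length →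
      ∀ d, (P i).support.getD q d ∉ frameStar (2 * h) P := by
    intro q h1 h2 d hq
    rw [support_getD_eq_getVert _ (by omega)] at hq
    have := hsh.1.of_mem_frameStar (by omega) hq
    omega
  have ha : alpha G (P i) x = (P i).getVert r := by
    rw [alpha, firstNbrIdx_support_eq hr hadj hlt, support_getD_eq_getVert _ hr]
  refine hd.2.2.1 i ⟨_, (P i).getVert_mem_support r, hadj⟩ ((P i).getVert t) ?_ hyt
  rw [ha]
  simp only [Kmn, listIdx_support_getVert (hsh.1.2.2.2.1 i) hr]
  rcases le_or_gt t r with h' | h'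
  · left
    exact ⟨t, h', by omega, fun q _ _ => hF q (by omega) (by omega) _,
      (support_getD_eq_getVert _ hti _).symm⟩
  · right
    exact ⟨t, h'.le, by rw [Walk.length_support]; omega, by omega,
      fun q _ _ => hF q (by omega) (by omega) _, (support_getD_eq_getVert _ hti _).symm⟩

end Translation

theorem fin_three_exists_ne (i j : Fin 3) : ∃ k : Fin 3, i ≠ k ∧ j ≠ k := by
  revert i j
  decide

theorem fin_three_eq_or {i j k : Fin 3} (hij : i ≠ j) (hik : i ≠ k) (hjk : j ≠ k) (q : Fin 3) :
    q = i ∨ q = j ∨ q = k := by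
  revert i j k q
  decide

namespace PrismCoords

variable {V : Type*} {G : SimpleGraph V} {h : ℕ} {p : Fin 3 → ℕ → V} {n : Fin 3 → ℕ}

theorem eq_of_eq (hC : PrismCoords G h p n) {i : Fin 3} {s t : ℕ} (hs : s ≤ n i) (ht : t ≤ n i)
    (he : p i s = p i t) : s = t :=
  (hC.seq i s t hs ht).1 he

theorem adj_iff_same (hC : PrismCoords G h p n) {i : Fin 3} {s t : ℕ} (hs : s ≤ n i)
    (ht : t ≤ n i) : G.Adj (p i s) (p i t) ↔ s + 1 = t ∨ t + 1 = s :=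
  (hC.seq i s t hs ht).2

theorem le_of_prism (hC : PrismCoords G h p n) {m j k : Fin 3} (hmj : m ≠ j) (hmk : m ≠ k)
    (hjk : j ≠ k) {a₀ a₁ a₂ b₀ b₁ b₂ : V} {S₀ S₁ S₂ : Set V} {l₀ l₁ l₂ : ℕ}
    (h₀ : InducedPathOn G a₀ b₀ S₀ l₀) (h₁ : InducedPathOn G a₁ b₁ S₁ l₁)
    (h₂ : InducedPathOn G a₂ b₂ S₂ l₂)
    (ha₀₁ : G.Adj a₀ a₁) (ha₀₂ : G.Adj a₀ a₂) (ha₁₂ : G.Adj a₁ a₂)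
    (hb₀₁ : G.Adj b₀ b₁) (hb₀₂ : G.Adj b₀ b₂) (hb₁₂ : G.Adj b₁ b₂)
    (hab₀ : a₀ ≠ b₀) (hab₁ : a₁ ≠ b₁)
    (hc₀₁ : PrismLinked G a₀ b₀ S₀ a₁ b₁ S₁) (hc₀₂ : PrismLinked G a₀ b₀ S₀ a₂ b₂ S₂)
    (hc₁₂ : PrismLinked G a₁ b₁ S₁ a₂ b₂ S₂)
    (hl₀₁ : 2 * h ≤ l₀ + l₁ + 2) (hl₀₂ : 2 * h ≤ l₀ + l₂ + 2) (hl₁₂ : 2 * h ≤ l₁ + l₂ + 2) :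
    n m + n j + n k ≤ l₀ + l₁ + l₂ := by
  have hsum : n m + n j + n k = n 0 + n 1 + n 2 := by
    revert hmj hmk hjk
    fin_cases m <;> fin_cases j <;> fin_cases k <;> simp <;> omega
  have h01 := (hc₀₁ _ h₀.left_mem _ h₁.right_mem).1
  have h02 := (hc₀₂ _ h₀.left_mem _ h₂.right_mem).1
  have h12 := (hc₁₂ _ h₁.left_mem _ h₂.right_mem).1
  have h10 := (hc₀₁.symm _ h₁.left_mem _ h₀.right_mem).1
  have h20 := (hc₀₂.symm _ h₂.left_mem _ h₀.right_mem).1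
  have h21 := (hc₁₂.symm _ h₂.left_mem _ h₁.right_mem).1
  rw [hsum]
  refine hC.shortest ![a₀, a₁, a₂] ![b₀, b₁, b₂] ![S₀, S₁, S₂] ![l₀, l₁, l₂] ?_ ?_ ?_ ?_ ?_ ?_
  · simp [Fin.forall_fin_succ, h₀, h₁, h₂]
  · simp [Fin.forall_fin_succ, ha₀₁, ha₀₂, ha₁₂, ha₀₁.symm, ha₀₂.symm, ha₁₂.symm]
  · simp [Fin.forall_fin_succ, hb₀₁, hb₀₂, hb₁₂, hb₀₁.symm, hb₀₂.symm, hb₁₂.symm]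
  · have key : ∀ v ∈ Set.range ![a₀, a₁, a₂] ∩ Set.range ![b₀, b₁, b₂], v = a₂ := by
      rintro v ⟨⟨s, rfl⟩, ⟨t, ht⟩⟩
      fin_cases s <;> fin_cases t <;> simp_all
    exact fun v hv v' hv' => (key v hv).trans (key v' hv').symm
  · simp [Fin.forall_fin_succ, hc₀₁, hc₀₂, hc₁₂, hc₀₁.symm, hc₀₂.symm, hc₁₂.symm]
  · simp only [Fin.forall_fin_succ]
    simp
    omega

theorem join_zero (hC : PrismCoords G h p n) {i j : Fin 3} (hij : i ≠ j) {r s : ℕ} (hr : r < n i)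
    (hs : s ≤ n j) :
    InducedPathOn G (p i r) (p j s)
      {v | (∃ t, t ≤ r ∧ v = p i t) ∨ ∃ t, t ≤ s ∧ v = p j t} (r + 1 + s) := by
  have h1 := (InducedPathOn.of_seq (hC.seq i) (Nat.zero_le r) hr.le).symm
  have h2 := InducedPathOn.of_seq (hC.seq j) (Nat.zero_le s) hs
  have h3 := InducedPathOn.cons
    ((hC.adj_iff i j hij 0 0 (by omega) (by omega)).2 (Or.inl ⟨rfl, rfl⟩))
    h2 (by
      rintro _ ⟨t, -, ht, rfl⟩
      refine ⟨hC.ne i j hij 0 t (by omega) (by omega), fun hadj => ?_⟩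
      rcases (hC.adj_iff i j hij 0 t (by omega) (by omega)).1 hadj with ⟨-, rfl⟩ | ⟨h0, -⟩
      · rfl
      · omega)
  have h4 := h1.append h3 (by
    rintro _ ⟨t, -, ht, rfl⟩ y (rfl | ⟨q, -, hq, rfl⟩) hxy
    · exact Or.inr rfl
    · left
      rcases hxy with hxy | hxy
      · exact (hC.ne i j hij t q (by omega) (by omega) hxy).elim
      · rcases (hC.adj_iff i j hij t q (by omega) (by omega)).1 hxy with ⟨rfl, -⟩ | ⟨h0, -⟩
        · rfl
        · omega)
  convert h4 using 1
  · ext v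
    constructor
    · rintro (⟨t, ht, rfl⟩ | ⟨t, ht, rfl⟩)
      · exact Or.inl ⟨t, Nat.zero_le _, ht, rfl⟩
      · exact Or.inr (Or.inr ⟨t, Nat.zero_le _, ht, rfl⟩)
    · rintro (⟨t, -, ht, rfl⟩ | rfl | ⟨t, -, ht, rfl⟩)
      · exact Or.inl ⟨t, ht, rfl⟩
      · exact Or.inl ⟨0, by omega, rfl⟩
      · exact Or.inr ⟨t, ht, rfl⟩
  · omega

theorem join_length (hC : PrismCoords G h p n) {i j : Fin 3} (hij : i ≠ j) {r s : ℕ} (hr : 0 < r)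
    (hrn : r ≤ n i) (hs : s ≤ n j) :
    InducedPathOn G (p i r) (p j s)
      {v | (∃ t, r ≤ t ∧ t ≤ n i ∧ v = p i t) ∨ ∃ t, s ≤ t ∧ t ≤ n j ∧ v = p j t}
      (n i - r + 1 + (n j - s)) := by
  have h1 := InducedPathOn.of_seq (hC.seq i) hrn le_rfl
  have h2 := (InducedPathOn.of_seq (hC.seq j) hs le_rfl).symm
  have h3 := InducedPathOn.cons
    ((hC.adj_iff i j hij (n i) (n j) le_rfl le_rfl).2 (Or.inr ⟨rfl, rfl⟩)) h2 (by
      rintro _ ⟨t, -, ht, rfl⟩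
      refine ⟨hC.ne i j hij _ t le_rfl (by omega), fun hadj => ?_⟩
      rcases (hC.adj_iff i j hij _ t le_rfl (by omega)).1 hadj with ⟨h0, -⟩ | ⟨-, rfl⟩
      · omega
      · rfl)
  have h4 := h1.append h3 (by
    rintro _ ⟨t, htr, ht, rfl⟩ y (rfl | ⟨q, -, hq, rfl⟩) hxy
    · exact Or.inr rfl
    · left
      rcases hxy with hxy | hxy
      · exact (hC.ne i j hij t q (by omega) (by omega) hxy).elim
      · rcases (hC.adj_iff i j hij t q (by omega) (by omega)).1 hxy with ⟨rfl, -⟩ | ⟨h0, -⟩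
        · omega
        · rw [h0])
  convert h4 using 1
  · ext v
    constructor
    · rintro (h | h)
      · exact Or.inl h
      · exact Or.inr (Or.inr h)
    · rintro (h | rfl | h)
      · exact Or.inl h
      · exact Or.inl ⟨n i, hrn, le_rfl, rfl⟩
      · exact Or.inr h
  · omega

/-- A vertex attaching to one constituent path only, in a widely spread way, would give a
smaller long near-prism. -/
theorem exists_adj_of_spread (hC : PrismCoords G h p n) (hh : 3 ≤ h) {x : V}
    (hxK : ∀ i t, t ≤ n i → x ≠ p i t)
    (hmaj : ∀ i c, c ≤ n i → ∃ j t, t ≤ n j ∧ G.Adj x (p j t) ∧ ¬ (j = i ∧ c ≤ t ∧ t ≤ c + 2))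
    {m j : Fin 3} (hmj : m ≠ j) (hm : ∀ t, t ≤ n m → ¬ G.Adj x (p m t)) :
    ∃ t, t ≤ n j ∧ G.Adj x (p j t) := by
  by_contra hj
  push Not at hj
  wlog hnm : 0 < n m generalizing m j with H
  · have := hC.long m j hmj
    exact H hmj.symm hj hm (by omega)
  obtain ⟨k, hmk, hjk⟩ := fin_three_exists_ne m j
  have hthree := fin_three_eq_or hmj hmk hjk
  have hk : ∀ c, c ≤ n k → ∃ t, t ≤ n k ∧ G.Adj x (p k t) ∧ ¬ (c ≤ t ∧ t ≤ c + 2) := by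
    intro c hc
    obtain ⟨q, t, ht, hadj, hnot⟩ := hmaj k c hc
    rcases hthree q with rfl | rfl | rfl
    · exact (hm t ht hadj).elim
    · exact (hj t ht hadj).elim
    · exact ⟨t, ht, hadj, fun h => hnot ⟨rfl, h⟩⟩
  obtain ⟨t₀, ht₀, hadj₀, -⟩ := hk 0 (Nat.zero_le _)
  obtain ⟨α, hα, hαadj, hαmin⟩ := exists_least_le (p := fun t => G.Adj x (p k t)) ht₀ hadj₀
  obtain ⟨β, hβ, hβadj, hβmax⟩ := exists_greatest_le (p := fun t => G.Adj x (p k t)) ht₀ hadj₀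
  obtain ⟨t₁, ht₁, hadj₁, hne₁⟩ := hk α hα
  have hαt : α ≤ t₁ := not_lt.1 fun h => hαmin _ h hadj₁
  have htβ : t₁ ≤ β := not_lt.1 fun h => hβmax _ ht₁ h hadj₁
  have hsα := hC.stub x hxK k α hα hαadj
  have hsβ := hC.stub x hxK k β hβ hβadj
  have q1 := InducedPathOn.cons hβadj (InducedPathOn.of_seq (hC.seq k) hβ le_rfl) (by
    rintro _ ⟨t, ht, htn, rfl⟩
    refine ⟨hxK k t htn, fun hadj => ?_⟩
    have : ¬ β < t := fun h => hβmax t htn h hadj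
    rw [show t = β by omega])
  have q2 := InducedPathOn.cons hαadj.symm q1 (by
    rintro _ (rfl | ⟨t, ht, htn, rfl⟩)
    · exact ⟨(hxK k α hα).symm, fun _ => rfl⟩
    · refine ⟨fun he => ?_, fun hadj => ?_⟩
      · have := hC.eq_of_eq hα htn he
        omega
      · have := (hC.adj_iff_same hα htn).1 hadj
        omega)
  have q3 := (InducedPathOn.of_seq (hC.seq k) (Nat.zero_le α) hα).append q2 (by
    rintro _ ⟨s, -, hs, rfl⟩ _ (rfl | rfl | ⟨t, ht, htn, rfl⟩) hxy
    · exact Or.inr rfl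
    · left
      rcases hxy with hxy | hxy
      · exact (hxK k s (by omega) hxy.symm).elim
      · have : ¬ s < α := fun h => hαmin s h hxy.symm
        rw [show s = α by omega]
    · rcases hxy with hxy | hxy
      · have := hC.eq_of_eq (by omega) htn hxy
        omega
      · have := (hC.adj_iff_same (by omega) htn).1 hxy
        omega)
  have hlink : ∀ q, q ≠ k → (∀ t, t ≤ n q → ¬ G.Adj x (p q t)) →
      PrismLinked G (p k 0) (p k (n k)) ({v | ∃ t, 0 ≤ t ∧ t ≤ α ∧ v = p k t} ∪
        insert (p k α) (insert x {v | ∃ t, β ≤ t ∧ t ≤ n k ∧ v = p k t}))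
        (p q 0) (p q (n q)) {v | ∃ t, 0 ≤ t ∧ t ≤ n q ∧ v = p q t} := by
    intro q hqk hq
    have hkt : ∀ s, s ≤ n k → ∀ t, t ≤ n q → p k s ≠ p q t ∧
        (G.Adj (p k s) (p q t) → p k s = p k 0 ∧ p q t = p q 0 ∨
          p k s = p k (n k) ∧ p q t = p q (n q)) := by
      intro s hs t ht
      refine ⟨hC.ne k q hqk.symm s t hs ht, fun hadj => ?_⟩
      rcases (hC.adj_iff k q hqk.symm s t hs ht).1 hadj with ⟨rfl, rfl⟩ | ⟨rfl, rfl⟩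
      · exact Or.inl ⟨rfl, rfl⟩
      · exact Or.inr ⟨rfl, rfl⟩
    rintro _ (⟨s, -, hs, rfl⟩ | rfl | rfl | ⟨s, hs, hsn, rfl⟩) _ ⟨t, -, ht, rfl⟩
    · exact hkt s (by omega) t ht
    · exact hkt α hα t ht
    · exact ⟨hxK q t ht, fun hadj => (hq t ht hadj).elim⟩
    · exact hkt s hsn t ht
  have hlmj : PrismLinked G (p m 0) (p m (n m)) {v | ∃ t, 0 ≤ t ∧ t ≤ n m ∧ v = p m t}
      (p j 0) (p j (n j)) {v | ∃ t, 0 ≤ t ∧ t ≤ n j ∧ v = p j t} := by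
    rintro _ ⟨s, -, hs, rfl⟩ _ ⟨t, -, ht, rfl⟩
    refine ⟨hC.ne m j hmj s t hs ht, fun hadj => ?_⟩
    rcases (hC.adj_iff m j hmj s t hs ht).1 hadj with ⟨rfl, rfl⟩ | ⟨rfl, rfl⟩
    · exact Or.inl ⟨rfl, rfl⟩
    · exact Or.inr ⟨rfl, rfl⟩
  have hz : ∀ i j, i ≠ j → G.Adj (p i 0) (p j 0) := fun i j hij =>
    (hC.adj_iff i j hij 0 0 (Nat.zero_le _) (Nat.zero_le _)).2 (Or.inl ⟨rfl, rfl⟩)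
  have hn : ∀ i j, i ≠ j → G.Adj (p i (n i)) (p j (n j)) := fun i j hij =>
    (hC.adj_iff i j hij _ _ le_rfl le_rfl).2 (Or.inr ⟨rfl, rfl⟩)
  have hnz : ∀ i, 0 < n i → p i 0 ≠ p i (n i) := fun i hi he => by
    have := hC.eq_of_eq (Nat.zero_le _) le_rfl he
    omega
  have hmjl := hC.long m j hmj
  have := hC.le_of_prism hmk.symm hjk.symm hmj q3
    (InducedPathOn.of_seq (hC.seq m) (Nat.zero_le _) le_rfl)
    (InducedPathOn.of_seq (hC.seq j) (Nat.zero_le _) le_rfl)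
    (hz _ _ hmk.symm) (hz _ _ hjk.symm) (hz _ _ hmj) (hn _ _ hmk.symm) (hn _ _ hjk.symm)
    (hn _ _ hmj) (hnz k (by omega)) (hnz m hnm) (hlink m hmk hm) (hlink j hjk hj) hlmj
    (by omega) (by omega) (by omega)
  omega

/-- A vertex with exactly two, consecutive, neighbours on one constituent path and none on a
second one has none on the third. -/
theorem not_adj_of_consecutive (hC : PrismCoords G h p n) (hh : 3 ≤ h) {w : V}
    (hwK : ∀ i t, t ≤ n i → w ≠ p i t) {m j k : Fin 3} (hmj : m ≠ j) (hmk : m ≠ k) (hjk : j ≠ k)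
    {c : ℕ} (hc : c + 1 ≤ n m) (hw : ∀ t, t ≤ n m → (G.Adj w (p m t) ↔ t = c ∨ t = c + 1))
    (hj : ∀ t, t ≤ n j → ¬ G.Adj w (p j t)) {t : ℕ} (ht : t ≤ n k) : ¬ G.Adj w (p k t) := by
  intro hadj
  obtain ⟨β, hβ, hβadj, hβmax⟩ := exists_greatest_le (p := fun t => G.Adj w (p k t)) ht hadj
  have hsβ := hC.stub w hwK k β hβ hβadj
  have hwc := (hw c (by omega)).2 (Or.inl rfl)
  have hwc' := (hw (c + 1) hc).2 (Or.inr rfl)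
  have hsc := hC.stub w hwK m _ hc hwc'
  have q0 := InducedPathOn.cons hβadj (InducedPathOn.of_seq (hC.seq k) hβ le_rfl) (by
    rintro _ ⟨t, ht, htn, rfl⟩
    refine ⟨hwK k t htn, fun hadj => ?_⟩
    have : ¬ β < t := fun h => hβmax t htn h hadj
    rw [show t = β by omega])
  have q1 := InducedPathOn.of_seq (hC.seq m) hc le_rfl
  have q2 := hC.join_zero hmj (show c < n m by omega) (le_refl (n j))
  have hn : ∀ i j, i ≠ j → G.Adj (p i (n i)) (p j (n j)) := fun i j hij =>
    (hC.adj_iff i j hij _ _ le_rfl le_rfl).2 (Or.inr ⟨rfl, rfl⟩)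
  have hmjl := hC.long m j hmj
  have := hC.le_of_prism hmk.symm hjk.symm hmj q0 q1 q2 hwc' hwc
    ((hC.adj_iff_same hc (by omega)).2 (Or.inr rfl)) (hn _ _ hmk.symm) (hn _ _ hjk.symm)
    (hn _ _ hmj) (hwK k _ le_rfl)
    (fun he => by
      have := hC.eq_of_eq hc le_rfl he
      omega)
    (by
      rintro _ (rfl | ⟨s, hs, hsn, rfl⟩) _ ⟨t, ht, htn, rfl⟩
      · refine ⟨hwK m t htn, fun hadj => ?_⟩
        have := (hw t htn).1 hadj
        rw [show t = c + 1 by omega]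
        exact Or.inl ⟨rfl, rfl⟩
      · refine ⟨hC.ne k m hmk.symm s t hsn htn, fun hadj => ?_⟩
        rcases (hC.adj_iff k m hmk.symm s t hsn htn).1 hadj with ⟨rfl, rfl⟩ | ⟨rfl, rfl⟩
        · omega
        · exact Or.inr ⟨rfl, rfl⟩)
    (by
      rintro _ (rfl | ⟨s, hs, hsn, rfl⟩) _ (⟨t, ht, rfl⟩ | ⟨t, ht, rfl⟩)
      · refine ⟨hwK m t (by omega), fun hadj => ?_⟩
        have := (hw t (by omega)).1 hadj
        rw [show t = c by omega]
        exact Or.inl ⟨rfl, rfl⟩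
      · exact ⟨hwK j t ht, fun hadj => (hj t ht hadj).elim⟩
      · refine ⟨hC.ne k m hmk.symm s t hsn (by omega), fun hadj => ?_⟩
        rcases (hC.adj_iff k m hmk.symm s t hsn (by omega)).1 hadj with ⟨rfl, rfl⟩ | ⟨rfl, rfl⟩ <;>
          omega
      · refine ⟨hC.ne k j hjk.symm s t hsn ht, fun hadj => ?_⟩
        rcases (hC.adj_iff k j hjk.symm s t hsn ht).1 hadj with ⟨rfl, rfl⟩ | ⟨rfl, rfl⟩
        · omega
        · exact Or.inr ⟨rfl, rfl⟩)
    (by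
      rintro _ ⟨s, hs, hsn, rfl⟩ _ (⟨t, ht, rfl⟩ | ⟨t, ht, rfl⟩)
      · refine ⟨fun he => ?_, fun hadj => ?_⟩
        · have := hC.eq_of_eq hsn (by omega) he
          omega
        · have := (hC.adj_iff_same hsn (by omega)).1 hadj
          rw [show s = c + 1 by omega, show t = c by omega]
          exact Or.inl ⟨rfl, rfl⟩
      · refine ⟨hC.ne m j hmj s t hsn ht, fun hadj => ?_⟩
        rcases (hC.adj_iff m j hmj s t hsn ht).1 hadj with ⟨rfl, rfl⟩ | ⟨rfl, rfl⟩
        · omega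
        · exact Or.inr ⟨rfl, rfl⟩)
    (by omega) (by omega) (by omega)
  omega

theorem hasLongTheta_of_unique_adj (hC : PrismCoords G h p n) (hh : 3 ≤ h) {x : V}
    (hxK : ∀ i t, t ≤ n i → x ≠ p i t) {i j : Fin 3} (hij : i ≠ j) {r s : ℕ} (hr : r ≤ n i)
    (hs : s ≤ n j) (hi : ∀ t, t ≤ n i → (G.Adj x (p i t) ↔ t = r))
    (hj : ∀ t, t ≤ n j → (G.Adj x (p j t) ↔ t = s)) : HasLongTheta G (2 * h) := by
  have hxr := (hi r hr).2 rfl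
  have hxs := (hj s hs).2 rfl
  have hsr := hC.stub x hxK i r hr hxr
  have hss := hC.stub x hxK j s hs hxs
  have hne := hC.ne i j hij r s hr hs
  have hnadj : ¬ G.Adj (p i r) (p j s) := by
    intro hadj
    have := (hC.adj_iff i j hij r s hr hs).1 hadj
    omega
  refine hasLongTheta_of_inducedPathOn hne hnadj
    (InducedPathOn.cons hxr.symm (InducedPathOn.edge hxs) (by
      rintro _ (rfl | rfl)
      · exact ⟨(hxK i r hr).symm, fun _ => rfl⟩
      · exact ⟨hne, fun hadj => (hnadj hadj).elim⟩))
    (hC.join_zero hij (show r < n i by omega) hs)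
    (hC.join_length hij (show 0 < r by omega) hr hs) ?_ ?_ ?_ (by omega) (by omega) (by omega)
  · rintro _ (rfl | rfl | rfl) _ (⟨t, ht, rfl⟩ | ⟨t, ht, rfl⟩) hxy
    · tauto
    · tauto
    · rcases hxy with hxy | hxy
      · exact (hxK _ _ (by omega) hxy).elim
      · rw [(hi t (by omega)).1 hxy]
        tauto
    · rcases hxy with hxy | hxy
      · exact (hxK _ _ (by omega) hxy).elim
      · rw [(hj t (by omega)).1 hxy]
        tauto
    · tauto
    · tauto
  · rintro _ (rfl | rfl | rfl) _ (⟨t, ht, htn, rfl⟩ | ⟨t, ht, htn, rfl⟩) hxy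
    · tauto
    · tauto
    · rcases hxy with hxy | hxy
      · exact (hxK _ _ (by omega) hxy).elim
      · rw [(hi t (by omega)).1 hxy]
        tauto
    · rcases hxy with hxy | hxy
      · exact (hxK _ _ (by omega) hxy).elim
      · rw [(hj t (by omega)).1 hxy]
        tauto
    · tauto
    · tauto
  · rintro _ (⟨q, hq, rfl⟩ | ⟨q, hq, rfl⟩) _ (⟨t, ht, htn, rfl⟩ | ⟨t, ht, htn, rfl⟩) hxy
    · have : q = r ∨ t = r := by
        rcases hxy with hxy | hxy
        · have := hC.eq_of_eq (by omega) htn hxy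
          omega
        · have := (hC.adj_iff_same (by omega) htn).1 hxy
          omega
      rcases this with rfl | rfl <;> tauto
    · rcases hxy with hxy | hxy
      · exact (hC.ne i j hij q t (by omega) htn hxy).elim
      · have := (hC.adj_iff i j hij q t (by omega) htn).1 hxy
        omega
    · rcases hxy with hxy | hxy
      · exact (hC.ne i j hij t q (by omega) (by omega) hxy.symm).elim
      · have := (hC.adj_iff i j hij t q (by omega) (by omega)).1 hxy.symm
        omega
    · have : q = s ∨ t = s := by
        rcases hxy with hxy | hxy
        · have := hC.eq_of_eq (by omega) htn hxy
          omega
        · have := (hC.adj_iff_same (by omega) htn).1 hxy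
          omega
      rcases this with rfl | rfl <;> tauto

end PrismCoords

section Hole

variable {V : Type*} {G : SimpleGraph V}

theorem InducedPathOn.two_le {u v : V} {S : Set V} {n : ℕ} (h : InducedPathOn G u v S n)
    (hne : u ≠ v) (hadj : ¬ G.Adj u v) : 2 ≤ n := by
  obtain ⟨f, hf, rfl, rfl, -⟩ := h.exists_seq
  by_contra hlt
  rcases (by omega : n = 0 ∨ n = 1) with rfl | rfl
  · exact hne rfl
  · exact hadj ((hf 0 1 (by omega) le_rfl).2.2 (Or.inl rfl))

/-- Let `e, g 0, …, g N` be a hole and let `w` be joined to `e` by a path avoiding the rest of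
the hole. If the neighbours of `w` on the hole are far from `e`, they are two consecutive
vertices, unless there is a long theta. -/
theorem exists_consecutive_of_far {ℓ : ℕ} (hℓ : 6 ≤ ℓ) (hnt : ¬ HasLongTheta G ℓ) {g : ℕ → V}
    {N d : ℕ} {e w : V} {R : Set V} (hg : InducedSeq G g N) (heg : ∀ t, t ≤ N → e ≠ g t)
    (hadj : ∀ t, t ≤ N → (G.Adj e (g t) ↔ t = 0 ∨ t = N)) (hwe : w ≠ e) (hwe' : ¬ G.Adj w e)
    (hwg : ∀ t, t ≤ N → w ≠ g t) (hR : InducedPathOn G w e R d)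
    (hRg : ∀ v ∈ R, v = w ∨ v = e ∨ ∀ t, t ≤ N → v ≠ g t ∧ ¬ G.Adj v (g t))
    (hfar : ∀ t, t ≤ N → G.Adj w (g t) → ℓ ≤ t + 3 ∧ t + ℓ ≤ N + 3)
    (hex : ∃ t, t ≤ N ∧ G.Adj w (g t)) :
    ∃ f, f + 1 ≤ N ∧ ∀ t, t ≤ N → (G.Adj w (g t) ↔ t = f ∨ t = f + 1) := by
  obtain ⟨t₀, ht₀, hadj₀⟩ := hex
  obtain ⟨f, hf, hfadj, hfmin⟩ := exists_least_le (p := fun t => G.Adj w (g t)) ht₀ hadj₀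
  obtain ⟨l, hl, hladj, hlmax⟩ := exists_greatest_le (p := fun t => G.Adj w (g t)) ht₀ hadj₀
  have hmin : ∀ t, G.Adj w (g t) → f ≤ t := fun t h => not_lt.1 fun h' => hfmin t h' h
  have hmax : ∀ t, t ≤ N → G.Adj w (g t) → t ≤ l := fun t ht h => not_lt.1 fun h' => hlmax t ht h' h
  have hfl := hmin l hladj
  have hff := hfar f hf hfadj
  have hlf := hfar l hl hladj
  have hd := hR.two_le hwe hwe'
  have hdown : InducedPathOn G e (g f) (insert e {v | ∃ t, 0 ≤ t ∧ t ≤ f ∧ v = g t}) (f - 0 + 1) :=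
    InducedPathOn.cons ((hadj 0 (Nat.zero_le _)).2 (Or.inl rfl))
      (InducedPathOn.of_seq hg (Nat.zero_le f) hf) (by
        rintro _ ⟨t, -, ht, rfl⟩
        refine ⟨heg t (by omega), fun h => ?_⟩
        have := (hadj t (by omega)).1 h
        rw [show t = 0 by omega])
  have hup : InducedPathOn G e (g l) (insert e {v | ∃ t, l ≤ t ∧ t ≤ N ∧ v = g t}) (N - l + 1) :=
    InducedPathOn.cons ((hadj N le_rfl).2 (Or.inr rfl))
      (InducedPathOn.of_seq hg hl le_rfl).symm (by
        rintro _ ⟨t, ht, htN, rfl⟩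
        refine ⟨heg t htN, fun h => ?_⟩
        have := (hadj t htN).1 h
        rw [show t = N by omega])
  have heR : ∀ t, 0 < t → t < N → ¬ G.Adj e (g t) := by
    intro t h1 h2 h3
    have := (hadj t (by omega)).1 h3
    omega
  rcases (by omega : l = f ∨ l = f + 1 ∨ f + 2 ≤ l) with rfl | rfl | hfl2
  · refine (hnt ?_).elim
    have hthird := (InducedPathOn.cons hfadj.symm hR (by
      intro y hy
      rcases hRg y hy with rfl | rfl | hy'
      · exact ⟨(hwg _ hf).symm, fun _ => rfl⟩
      · exact ⟨(heg _ hf).symm, fun h => (heR _ (by omega) (by omega) h.symm).elim⟩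
      · exact ⟨(hy' _ hf).1.symm, fun h => ((hy' _ hf).2 h.symm).elim⟩)).symm
    have hRcross : ∀ s, s ≤ N → ∀ y ∈ insert (g l) R, (g s = y ∨ G.Adj (g s) y) →
        g s = e ∨ g s = g l ∨ y = e ∨ y = g l := by
      rintro s hs y (rfl | hy) hxy
      · tauto
      · rcases hRg y hy with rfl | rfl | hy'
        · rcases hxy with hxy | hxy
          · exact (hwg s hs hxy.symm).elim
          · have h1 := hmin s hxy.symm
            have h2 := hmax s hs hxy.symm
            rw [show s = l by omega]
            tauto
        · tauto
        · rcases hxy with hxy | hxy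
          · exact ((hy' s hs).1 hxy.symm).elim
          · exact ((hy' s hs).2 hxy.symm).elim
    refine hasLongTheta_of_inducedPathOn (heg _ hf) (heR _ (by omega) (by omega)) hdown hup hthird
      ?_ ?_ ?_ (by omega) (by omega) (by omega)
    · rintro _ (rfl | ⟨s, -, hs, rfl⟩) _ (rfl | ⟨t, ht, htN, rfl⟩) hxy
      · tauto
      · tauto
      · tauto
      · have : s = l ∨ t = l := by
          rcases hxy with hxy | hxy
          · have := (hg s t (by omega) htN).1 hxy
            omega
          · have := (hg s t (by omega) htN).2.1 hxy
            omega
        rcases this with rfl | rfl <;> tauto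
    · rintro _ (rfl | ⟨s, -, hs, rfl⟩) y hy hxy
      · tauto
      · exact hRcross s (by omega) y hy hxy
    · rintro _ (rfl | ⟨s, hs, hsN, rfl⟩) y hy hxy
      · tauto
      · exact hRcross s hsN y hy hxy
  · refine ⟨f, hl, fun t ht => ⟨fun h => ?_, ?_⟩⟩
    · have h1 := hmin t h
      have h2 := hmax t ht h
      omega
    · rintro (rfl | rfl)
      · exact hfadj
      · exact hladj
  · refine (hnt ?_).elim
    have h1 := InducedPathOn.cons hfadj hdown.symm (by
      rintro _ (rfl | ⟨t, -, ht, rfl⟩)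
      · exact ⟨hwe, fun h => (hwe' h).elim⟩
      · refine ⟨hwg t (by omega), fun h => ?_⟩
        have := hmin t h
        rw [show t = f by omega])
    have h2 := InducedPathOn.cons hladj hup.symm (by
      rintro _ (rfl | ⟨t, ht, htN, rfl⟩)
      · exact ⟨hwe, fun h => (hwe' h).elim⟩
      · refine ⟨hwg t htN, fun h => ?_⟩
        have := hmax t htN h
        rw [show t = l by omega])
    have hRcross : ∀ s, s ≤ N → ∀ y ∈ R, (g s = y ∨ G.Adj (g s) y) → y = w ∨ y = e := by
      intro s hs y hy hxy
      rcases hRg y hy with rfl | rfl | hy'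
      · tauto
      · tauto
      · rcases hxy with hxy | hxy
        · exact ((hy' s hs).1 hxy.symm).elim
        · exact ((hy' s hs).2 hxy.symm).elim
    refine hasLongTheta_of_inducedPathOn hwe hwe' h1 h2 hR ?_ ?_ ?_ (by omega) (by omega) (by omega)
    · rintro _ (rfl | rfl | ⟨s, -, hs, rfl⟩) _ (rfl | rfl | ⟨t, ht, htN, rfl⟩) hxy
      · tauto
      · tauto
      · tauto
      · tauto
      · tauto
      · tauto
      · tauto
      · tauto
      · rcases hxy with hxy | hxy
        · have := (hg s t (by omega) htN).1 hxy
          omega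
        · have := (hg s t (by omega) htN).2.1 hxy
          omega
    · rintro _ (rfl | rfl | ⟨s, -, hs, rfl⟩) y hy hxy
      · tauto
      · tauto
      · have := hRcross s (by omega) y hy hxy
        tauto
    · rintro _ (rfl | rfl | ⟨s, hs, hsN, rfl⟩) y hy hxy
      · tauto
      · tauto
      · have := hRcross s hsN y hy hxy
        tauto

end Hole

theorem InducedSeq.of_lt {V : Type*} {G : SimpleGraph V} {f : ℕ → V} {N : ℕ}
    (hf : ∀ s t, s < t → t ≤ N → f s ≠ f t ∧ (G.Adj (f s) (f t) ↔ s + 1 = t)) :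
    InducedSeq G f N := by
  intro s t hs ht
  rcases lt_trichotomy s t with hst | rfl | hst
  · have := hf s t hst ht
    refine ⟨fun h => (this.1 h).elim, this.2.trans ⟨Or.inl, fun h => by omega⟩⟩
  · simp
  · have := hf t s hst hs
    refine ⟨fun h => (this.1 h.symm).elim, ?_⟩
    rw [G.adj_comm]
    exact this.2.trans ⟨Or.inr, fun h => by omega⟩

/-- Walk down the path `i` of a near-prism from position `r`, up the path `j`, and down the
path `i` again from its other end. -/
def prismWind {V : Type*} (p : Fin 3 → ℕ → V) (n : Fin 3 → ℕ) (i j : Fin 3) (r t : ℕ) : V :=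
  if t ≤ r then p i (r - t)
  else if t ≤ r + 1 + n j then p j (t - (r + 1)) else p i (n i + (r + n j + 2) - t)

section Wind

variable {V : Type*} {p : Fin 3 → ℕ → V} {n : Fin 3 → ℕ} {i j : Fin 3} {r t : ℕ}

theorem prismWind_of_le (h : t ≤ r) : prismWind p n i j r t = p i (r - t) := if_pos h

theorem prismWind_of_lt_of_le (h : r < t) (h' : t ≤ r + 1 + n j) :
    prismWind p n i j r t = p j (t - (r + 1)) := by
  rw [prismWind, if_neg (by omega), if_pos h']

theorem prismWind_of_lt (h : r + 1 + n j < t) :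
    prismWind p n i j r t = p i (n i + (r + n j + 2) - t) := by
  rw [prismWind, if_neg (by omega), if_neg (by omega)]

theorem prismWind_cases (p : Fin 3 → ℕ → V) (n : Fin 3 → ℕ) (i j : Fin 3) (r t : ℕ) :
    (t ≤ r ∧ prismWind p n i j r t = p i (r - t)) ∨
    (r < t ∧ t ≤ r + 1 + n j ∧ prismWind p n i j r t = p j (t - (r + 1))) ∨
    (r + 1 + n j < t ∧ prismWind p n i j r t = p i (n i + (r + n j + 2) - t)) := by
  rcases le_or_gt t r with h | h
  · exact Or.inl ⟨h, prismWind_of_le h⟩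
  · rcases le_or_gt t (r + 1 + n j) with h' | h'
    · exact Or.inr (Or.inl ⟨h, h', prismWind_of_lt_of_le h h'⟩)
    · exact Or.inr (Or.inr ⟨h', prismWind_of_lt h'⟩)

end Wind

namespace PrismCoords

variable {V : Type*} {G : SimpleGraph V} {h : ℕ} {p : Fin 3 → ℕ → V} {n : Fin 3 → ℕ}

theorem inducedSeq_prismWind (hC : PrismCoords G h p n) {i j : Fin 3} (hij : i ≠ j) {r β N : ℕ}
    (hrβ : r + 2 ≤ β) (hβ : β ≤ n i) (hN : N ≤ r + n j + 2 + (n i - β)) :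
    InducedSeq G (prismWind p n i j r) N := by
  refine InducedSeq.of_lt fun s t hst ht => ?_
  rcases prismWind_cases p n i j r s with ⟨h1, e1⟩ | ⟨h1, h1', e1⟩ | ⟨h1, e1⟩ <;>
  rcases prismWind_cases p n i j r t with ⟨h2, e2⟩ | ⟨h2, h2', e2⟩ | ⟨h2, e2⟩ <;>
  first
  | omega
  | (rw [e1, e2]
     first
     | (rw [hC.adj_iff_same (by omega) (by omega)]
        refine ⟨fun h => ?_, by omega⟩
        have := hC.eq_of_eq (by omega) (by omega) h
        omega)
     | (rw [hC.adj_iff _ _ hij _ _ (by omega) (by omega)]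
        exact ⟨hC.ne _ _ hij _ _ (by omega) (by omega), by omega⟩)
     | (rw [hC.adj_iff _ _ hij.symm _ _ (by omega) (by omega)]
        exact ⟨hC.ne _ _ hij.symm _ _ (by omega) (by omega), by omega⟩))

/-- The hole formed by `e` and a winding sequence leaves no room for the neighbours of `w`. -/
theorem false_of_prismWind (hC : PrismCoords G h p n) (hh : 3 ≤ h)
    (hnt : ¬ HasLongTheta G (2 * h)) {w : V} (hwK : ∀ i t, t ≤ n i → w ≠ p i t)
    {i j k : Fin 3} (hij : i ≠ j) (hik : i ≠ k) (hjk : j ≠ k) {r β N : ℕ}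
    (hrβ : r + 2 ≤ β) (hβ : β ≤ n i) (hrN : r ≤ N) (hN : N ≤ r + n j + 2 + (n i - β)) {e : V}
    (heg : ∀ t, t ≤ N → e ≠ prismWind p n i j r t)
    (hadj : ∀ t, t ≤ N → (G.Adj e (prismWind p n i j r t) ↔ t = 0 ∨ t = N))
    (hwe : w ≠ e) (hwe' : ¬ G.Adj w e) {T : Set V} (hT : JoinedInside G T w e)
    (hTg : ∀ v ∈ T, v = w ∨ v = e ∨
      ∀ t, t ≤ N → v ≠ prismWind p n i j r t ∧ ¬ G.Adj v (prismWind p n i j r t))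
    (hwi : ∀ t, t ≤ n i → G.Adj w (p i t) →
      t ≤ r ∧ t + 2 * h ≤ r + 3 ∧ r + 2 * h ≤ N + t + 3)
    (hwj : ∀ t, t ≤ n j → G.Adj w (p j t) →
      r + 1 + t ≤ N ∧ 2 * h ≤ r + t + 4 ∧ r + 1 + t + 2 * h ≤ N + 3)
    (hex : (∃ t, t ≤ n i ∧ G.Adj w (p i t)) ∨ ∃ t, t ≤ n j ∧ G.Adj w (p j t))
    (hwk : ∃ t, t ≤ n k ∧ G.Adj w (p k t)) : False := by
  obtain ⟨c, hc, hcw⟩ := hwk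
  have hg := hC.inducedSeq_prismWind hij hrβ hβ hN
  obtain ⟨R, d, hR, hRT⟩ := hT.exists_inducedPathOn
  have hlow : ∀ t, t ≤ r → prismWind p n i j r (r - t) = p i t := fun t ht => by
    rw [prismWind_of_le (by omega), show r - (r - t) = t by omega]
  have hmid : ∀ t, t ≤ n j → prismWind p n i j r (r + 1 + t) = p j t := fun t ht => by
    rw [prismWind_of_lt_of_le (by omega) (by omega), show r + 1 + t - (r + 1) = t by omega]
  have hex' : ∃ t, t ≤ N ∧ G.Adj w (prismWind p n i j r t) := by
    rcases hex with ⟨t, ht, h2⟩ | ⟨t, ht, h2⟩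
    · have := hwi t ht h2
      exact ⟨r - t, by omega, by rwa [hlow t (by omega)]⟩
    · have := hwj t ht h2
      exact ⟨r + 1 + t, by omega, by rwa [hmid t ht]⟩
  clear hex
  have hwg : ∀ t, t ≤ N → w ≠ prismWind p n i j r t := by
    intro t ht
    rcases prismWind_cases p n i j r t with ⟨h1, e1⟩ | ⟨h1, h1', e1⟩ | ⟨h1, e1⟩ <;> rw [e1] <;>
      exact hwK _ _ (by omega)
  have hfar : ∀ t, t ≤ N → G.Adj w (prismWind p n i j r t) → 2 * h ≤ t + 3 ∧ t + 2 * h ≤ N + 3 := by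
    intro t ht
    rcases prismWind_cases p n i j r t with ⟨h1, e1⟩ | ⟨h1, h1', e1⟩ | ⟨h1, e1⟩ <;> rw [e1] <;>
      intro h2
    · have := hwi _ (by omega) h2
      omega
    · have := hwj _ (by omega) h2
      omega
    · have := hwi _ (by omega) h2
      omega
  obtain ⟨f, hf, hfw⟩ := exists_consecutive_of_far (by omega) hnt hg heg hadj hwe hwe' hwg hR
    (fun v hv => hTg v (hRT hv)) hfar hex'
  have hi : ∀ t, t ≤ n i → (G.Adj w (p i t) ↔ t ≤ r ∧ (r - t = f ∨ r - t = f + 1)) := by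
    intro t ht
    constructor
    · intro h2
      have := hwi t ht h2
      exact ⟨by omega, (hfw (r - t) (by omega)).1 (by rwa [hlow t (by omega)])⟩
    · rintro ⟨h1, h2⟩
      rw [← hlow t h1]
      exact (hfw (r - t) (by omega)).2 h2
  have hj : ∀ t, t ≤ n j → (G.Adj w (p j t) ↔ r + 1 + t = f ∨ r + 1 + t = f + 1) := by
    intro t ht
    constructor
    · intro h2
      have := hwj t ht h2
      exact (hfw (r + 1 + t) (by omega)).1 (by rwa [hmid t ht])
    · intro h2
      rw [← hmid t ht]
      exact (hfw (r + 1 + t) (by omega)).2 h2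
  rcases (by omega : f + 1 ≤ r ∨ f = r ∨ (r < f ∧ f < r + 1 + n j) ∨ f = r + 1 + n j ∨
    r + 1 + n j < f) with h1 | h1 | h1 | h1 | h1
  · refine hC.not_adj_of_consecutive hh hwK hij hik hjk (c := r - f - 1) (by omega) ?_ ?_ hc hcw
    · intro t ht
      rw [hi t ht]
      omega
    · intro t ht h2
      rw [hj t ht] at h2
      omega
  · have := (hi 0 (by omega)).2 (by omega)
    have := hC.stub w hwK i 0 (by omega) this
    omega
  · refine hC.not_adj_of_consecutive hh hwK hij.symm hjk hik (c := f - r - 1) (by omega)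
      ?_ ?_ hc hcw
    · intro t ht
      rw [hj t ht]
      omega
    · intro t ht h2
      rw [hi t ht] at h2
      omega
  · have := (hj (n j) le_rfl).2 (by omega)
    have := hC.stub w hwK j _ le_rfl this
    omega
  · have h2 := (hfw f (by omega)).2 (Or.inl rfl)
    rw [prismWind_of_lt (by omega)] at h2
    have := hwi _ (by omega) h2
    omega

theorem joinedInside (hC : PrismCoords G h p n) {k : Fin 3} {T : Set V} {a b lo hi : ℕ}
    (hT : ∀ t, lo ≤ t → t ≤ hi → p k t ∈ T) (hhi : hi ≤ n k) (ha : lo ≤ a) (ha' : a ≤ hi)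
    (hb : lo ≤ b) (hb' : b ≤ hi) : JoinedInside G T (p k a) (p k b) := by
  wlog hab : a ≤ b generalizing a b
  · exact (this hb hb' ha ha' (by omega)).symm
  exact JoinedInside.of_seq hab
    (fun t h1 h2 => (hC.adj_iff_same (by omega) (by omega)).2 (Or.inl rfl))
    (fun t h1 h2 => hT t (by omega) (by omega))

/-- A vertex `w` cannot see the initial segments cut off by the first neighbours of `x` on two
constituent paths, and the third path, without seeing the rest of the first two. -/
theorem false_of_adj_both (hC : PrismCoords G h p n) (hh : 3 ≤ h)
    (hnt : ¬ HasLongTheta G (2 * h)) {x w : V} (hxK : ∀ i t, t ≤ n i → x ≠ p i t)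
    (hwK : ∀ i t, t ≤ n i → w ≠ p i t) (hwx : w ≠ x) (hwx' : ¬ G.Adj w x)
    {i j k : Fin 3} (hij : i ≠ j) (hik : i ≠ k) (hjk : j ≠ k) {r s : ℕ}
    (hr : r ≤ n i) (hxr : G.Adj x (p i r)) (hrmin : ∀ t, t < r → ¬ G.Adj x (p i t))
    (hs : s ≤ n j) (hxs : G.Adj x (p j s)) (hsmin : ∀ t, t < s → ¬ G.Adj x (p j t))
    (hwi : ∀ t, t ≤ n i → G.Adj w (p i t) → t + (2 * h - 2) < r)
    (hwj : ∀ t, t ≤ n j → G.Adj w (p j t) → t + (2 * h - 2) < s)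
    (hex : (∃ t, t ≤ n i ∧ G.Adj w (p i t)) ∨ ∃ t, t ≤ n j ∧ G.Adj w (p j t))
    (hwk : ∃ t, t ≤ n k ∧ G.Adj w (p k t)) : False := by
  have hsr := hC.stub x hxK i r hr hxr
  have hss := hC.stub x hxK j s hs hxs
  let T : Set V := {v | v = w ∨ v = x ∨ (∃ t, 1 ≤ t ∧ t ≤ n k ∧ v = p k t) ∨
    (∃ t, r + 2 ≤ t ∧ t ≤ n i ∧ v = p i t) ∨ ∃ t, s + 2 ≤ t ∧ t ≤ n j ∧ v = p j t}
  have hwT : w ∈ T := Or.inl rfl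
  have hxT : x ∈ T := Or.inr (Or.inl rfl)
  have hkT : ∀ t, 1 ≤ t → t ≤ n k → p k t ∈ T := fun t h1 h2 =>
    Or.inr (Or.inr (Or.inl ⟨t, h1, h2, rfl⟩))
  have hiT : ∀ t, r + 2 ≤ t → t ≤ n i → p i t ∈ T := fun t h1 h2 =>
    Or.inr (Or.inr (Or.inr (Or.inl ⟨t, h1, h2, rfl⟩)))
  have hjT : ∀ t, s + 2 ≤ t → t ≤ n j → p j t ∈ T := fun t h1 h2 =>
    Or.inr (Or.inr (Or.inr (Or.inr ⟨t, h1, h2, rfl⟩)))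
  have hnn : ∀ i j, i ≠ j → G.Adj (p i (n i)) (p j (n j)) := fun i j hij =>
    (hC.adj_iff i j hij _ _ le_rfl le_rfl).2 (Or.inr ⟨rfl, rfl⟩)
  have hkj : ∀ v, v ∉ {v | ∃ i t, t ≤ n i ∧ v = p i t} → v ∈ T →
      (∃ t, t ≤ n k ∧ G.Adj v (p k t)) → JoinedInside G T v (p k (n k)) := by
    rintro v hvK hvT ⟨t, ht, hadj⟩
    have := hC.stub v (fun i t ht h => hvK ⟨i, t, ht, h⟩) k t ht hadj
    exact (JoinedInside.of_adj hvT (hkT t (by omega) ht) hadj).trans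
      (hC.joinedInside hkT le_rfl (by omega) ht (by omega) le_rfl)
  have hw : JoinedInside G T w (p k (n k)) :=
    hkj w (fun ⟨i, t, ht, h⟩ => hwK i t ht h) hwT hwk
  have hx : JoinedInside G T x (p k (n k)) := by
    by_cases hxk : ∃ t, t ≤ n k ∧ G.Adj x (p k t)
    · exact hkj x (fun ⟨i, t, ht, h⟩ => hxK i t ht h) hxT hxk
    push Not at hxk
    have hnk : 1 ≤ n k := by
      obtain ⟨c, hc, hcw⟩ := hwk
      have := hC.stub w hwK k c hc hcw
      omega
    by_cases hxi : ∃ t, r + 2 ≤ t ∧ t ≤ n i ∧ G.Adj x (p i t)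
    · obtain ⟨t, h1, h2, h3⟩ := hxi
      exact ((JoinedInside.of_adj hxT (hiT t h1 h2) h3).trans
        (hC.joinedInside hiT le_rfl h1 h2 (by omega) le_rfl)).trans
        (JoinedInside.of_adj (hiT _ (by omega) le_rfl) (hkT _ hnk le_rfl) (hnn i k hik))
    by_cases hxj : ∃ t, s + 2 ≤ t ∧ t ≤ n j ∧ G.Adj x (p j t)
    · obtain ⟨t, h1, h2, h3⟩ := hxj
      exact ((JoinedInside.of_adj hxT (hjT t h1 h2) h3).trans
        (hC.joinedInside hjT le_rfl h1 h2 (by omega) le_rfl)).trans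
        (JoinedInside.of_adj (hjT _ (by omega) le_rfl) (hkT _ hnk le_rfl) (hnn j k hjk))
    push Not at hxi hxj
    exfalso
    by_cases hr1 : G.Adj x (p i (r + 1))
    · refine hC.not_adj_of_consecutive hh hxK hik hij hjk.symm (c := r) (by omega) ?_ hxk hs hxs
      intro t ht
      refine ⟨fun h1 => ?_, ?_⟩
      · by_contra h2
        rcases lt_or_ge t r with h3 | h3
        · exact hrmin t h3 h1
        · exact hxi t (by omega) ht h1
      · rintro (rfl | rfl)
        · exact hxr
        · exact hr1
    by_cases hs1 : G.Adj x (p j (s + 1))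
    · refine hC.not_adj_of_consecutive hh hxK hjk hij.symm hik.symm (c := s) (by omega)
        ?_ hxk hr hxr
      intro t ht
      refine ⟨fun h1 => ?_, ?_⟩
      · by_contra h2
        rcases lt_or_ge t s with h3 | h3
        · exact hsmin t h3 h1
        · exact hxj t (by omega) ht h1
      · rintro (rfl | rfl)
        · exact hxs
        · exact hs1
    refine hnt (hC.hasLongTheta_of_unique_adj hh hxK hij hr hs ?_ ?_)
    · intro t ht
      refine ⟨fun h1 => ?_, fun h1 => h1 ▸ hxr⟩
      rcases lt_trichotomy t r with h2 | h2 | h2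
      · exact (hrmin t h2 h1).elim
      · exact h2
      · rcases (by omega : t = r + 1 ∨ r + 2 ≤ t) with rfl | h3
        · exact (hr1 h1).elim
        · exact (hxi t h3 ht h1).elim
    · intro t ht
      refine ⟨fun h1 => ?_, fun h1 => h1 ▸ hxs⟩
      rcases lt_trichotomy t s with h2 | h2 | h2
      · exact (hsmin t h2 h1).elim
      · exact h2
      · rcases (by omega : t = s + 1 ∨ s + 2 ≤ t) with rfl | h3
        · exact (hs1 h1).elim
        · exact (hxj t h3 ht h1).elim
  refine hC.false_of_prismWind hh hnt hwK hij hik hjk (r := r) (β := n i) (N := r + 1 + s)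
    (by omega) le_rfl (by omega) (by omega) (e := x) ?_ ?_ hwx hwx' (hw.trans hx.symm)
    ?_ ?_ ?_ hex hwk
  · intro t ht
    rcases prismWind_cases p n i j r t with ⟨h1, e1⟩ | ⟨h1, h1', e1⟩ | ⟨h1, e1⟩ <;> rw [e1] <;>
      exact hxK _ _ (by omega)
  · intro t ht
    rcases prismWind_cases p n i j r t with ⟨h1, e1⟩ | ⟨h1, h1', e1⟩ | ⟨h1, e1⟩
    · rw [e1]
      refine ⟨fun h2 => ?_, fun h2 => ?_⟩
      · have : ¬ r - t < r := fun h3 => hrmin _ h3 h2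
        omega
      · rwa [show r - t = r by omega]
    · rw [e1]
      refine ⟨fun h2 => ?_, fun h2 => ?_⟩
      · have : ¬ t - (r + 1) < s := fun h3 => hsmin _ h3 h2
        omega
      · rwa [show t - (r + 1) = s by omega]
    · omega
  · rintro v (rfl | rfl | ⟨q, h1, h2, rfl⟩ | ⟨q, h1, h2, rfl⟩ | ⟨q, h1, h2, rfl⟩)
    · exact Or.inl rfl
    · exact Or.inr (Or.inl rfl)
    · refine Or.inr (Or.inr fun t ht => ?_)
      rcases prismWind_cases p n i j r t with ⟨h3, e1⟩ | ⟨h3, h3', e1⟩ | ⟨h3, e1⟩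
      · rw [e1, hC.adj_iff k i hik.symm _ _ h2 (by omega)]
        exact ⟨hC.ne k i hik.symm _ _ h2 (by omega), by omega⟩
      · rw [e1, hC.adj_iff k j hjk.symm _ _ h2 (by omega)]
        exact ⟨hC.ne k j hjk.symm _ _ h2 (by omega), by omega⟩
      · omega
    · refine Or.inr (Or.inr fun t ht => ?_)
      rcases prismWind_cases p n i j r t with ⟨h3, e1⟩ | ⟨h3, h3', e1⟩ | ⟨h3, e1⟩
      · rw [e1, hC.adj_iff_same h2 (by omega)]
        refine ⟨fun he => ?_, by omega⟩
        have := hC.eq_of_eq h2 (by omega) he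
        omega
      · rw [e1, hC.adj_iff i j hij _ _ h2 (by omega)]
        exact ⟨hC.ne i j hij _ _ h2 (by omega), by omega⟩
      · omega
    · refine Or.inr (Or.inr fun t ht => ?_)
      rcases prismWind_cases p n i j r t with ⟨h3, e1⟩ | ⟨h3, h3', e1⟩ | ⟨h3, e1⟩
      · rw [e1, hC.adj_iff j i hij.symm _ _ h2 (by omega)]
        exact ⟨hC.ne j i hij.symm _ _ h2 (by omega), by omega⟩
      · rw [e1, hC.adj_iff_same h2 (by omega)]
        refine ⟨fun he => ?_, by omega⟩
        have := hC.eq_of_eq h2 (by omega) he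
        omega
      · omega
  · intro t ht h1
    have := hC.stub w hwK i t ht h1
    have := hwi t ht h1
    omega
  · intro t ht h1
    have := hC.stub w hwK j t ht h1
    have := hwj t ht h1
    omega

theorem false_of_adj_one (hC : PrismCoords G h p n) (hh : 3 ≤ h)
    (hnt : ¬ HasLongTheta G (2 * h)) {x w : V} (hxK : ∀ i t, t ≤ n i → x ≠ p i t)
    (hwK : ∀ i t, t ≤ n i → w ≠ p i t) (hwx : w ≠ x) (hwx' : ¬ G.Adj w x)
    {i j k : Fin 3} (hij : i ≠ j) (hik : i ≠ k) (hjk : j ≠ k) {r : ℕ}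
    (hr : r ≤ n i) (hxr : G.Adj x (p i r)) (hrmin : ∀ t, t < r → ¬ G.Adj x (p i t))
    (hxj : ∀ t, t ≤ n j → ¬ G.Adj x (p j t)) (hxk : ∃ t, t ≤ n k ∧ G.Adj x (p k t))
    (hwi : ∀ t, t ≤ n i → G.Adj w (p i t) → t + (2 * h - 2) < r)
    (hex : (∃ t, t ≤ n i ∧ G.Adj w (p i t)) ∨ ∃ t, t ≤ n j ∧ G.Adj w (p j t))
    (hwk : ∃ t, t ≤ n k ∧ G.Adj w (p k t)) : False := by
  obtain ⟨β, hβ, hxβ, hβmax⟩ := exists_greatest_le (p := fun t => G.Adj x (p i t)) hr hxr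
  have hmin : ∀ t, G.Adj x (p i t) → r ≤ t := fun t h1 => not_lt.1 fun h2 => hrmin t h2 h1
  have hmax : ∀ t, t ≤ n i → G.Adj x (p i t) → t ≤ β := fun t ht h1 =>
    not_lt.1 fun h2 => hβmax t ht h2 h1
  have hrβ := hmin β hxβ
  have hsr := hC.stub x hxK i r hr hxr
  have hsβ := hC.stub x hxK i β hβ hxβ
  obtain ⟨c, hc, hxc⟩ := hxk
  obtain ⟨c', hc', hwc'⟩ := id hwk
  have hsc := hC.stub x hxK k c hc hxc
  have hsc' := hC.stub w hwK k c' hc' hwc'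
  let T : Set V := {v | v = w ∨ v = x ∨ ∃ t, 1 ≤ t ∧ t ≤ n k - 1 ∧ v = p k t}
  have hkT : ∀ t, 1 ≤ t → t ≤ n k - 1 → p k t ∈ T := fun t h1 h2 =>
    Or.inr (Or.inr ⟨t, h1, h2, rfl⟩)
  have hwT : w ∈ T := Or.inl rfl
  have hxT : x ∈ T := Or.inr (Or.inl rfl)
  have hwxT : JoinedInside G T w x :=
    ((JoinedInside.of_adj hwT (hkT c' (by omega) (by omega)) hwc').trans
      (hC.joinedInside (b := c) hkT (Nat.sub_le _ _) (by omega) (by omega) (by omega)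
        (by omega))).trans (JoinedInside.of_adj hxT (hkT c (by omega) (by omega)) hxc).symm
  have hkanti : ∀ {r' N : ℕ}, r' ≤ n i → (∀ t, t ≤ N → t ≤ n i + (r' + n j + 2)) →
      ∀ q, 1 ≤ q → q ≤ n k - 1 → ∀ t, t ≤ N →
        p k q ≠ prismWind p n i j r' t ∧ ¬ G.Adj (p k q) (prismWind p n i j r' t) := by
    intro r' N hr' hN q h1 h2 t ht
    have := hN t ht
    rcases prismWind_cases p n i j r' t with ⟨h3, e1⟩ | ⟨h3, h3', e1⟩ | ⟨h3, e1⟩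
    · rw [e1, hC.adj_iff k i hik.symm _ _ (by omega) (by omega)]
      exact ⟨hC.ne k i hik.symm _ _ (by omega) (by omega), by omega⟩
    · rw [e1, hC.adj_iff k j hjk.symm _ _ (by omega) (by omega)]
      exact ⟨hC.ne k j hjk.symm _ _ (by omega) (by omega), by omega⟩
    · rw [e1, hC.adj_iff k i hik.symm _ _ (by omega) (by omega)]
      exact ⟨hC.ne k i hik.symm _ _ (by omega) (by omega), by omega⟩
  rcases (by omega : β = r ∨ β = r + 1 ∨ r + 2 ≤ β) with rfl | rfl | hrβ2
  · have hweK : w ≠ p i β := hwK i β hβ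
    have hwe' : ¬ G.Adj w (p i β) := fun h1 => by
      have := hwi β hβ h1
      omega
    refine hC.false_of_prismWind hh hnt hwK hij hik hjk (r := β - 1) (β := β + 1)
      (N := β - 1 + n j + 2 + (n i - (β + 1))) (by omega) (by omega) (by omega) le_rfl (e := p i β)
      ?_ ?_ hweK hwe' (T := insert (p i β) T)
      ((hwxT.mono (Set.subset_insert _ _)).trans
        (JoinedInside.of_adj (Set.mem_insert_of_mem _ hxT) (Set.mem_insert _ _) hxr))
      ?_ ?_ ?_ hex hwk
    · intro t ht
      rcases prismWind_cases p n i j (β - 1) t with ⟨h1, e1⟩ | ⟨h1, h1', e1⟩ | ⟨h1, e1⟩ <;> rw [e1]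
      · intro he
        have := hC.eq_of_eq hβ (by omega) he
        omega
      · exact hC.ne i j hij _ _ hβ (by omega)
      · intro he
        have := hC.eq_of_eq hβ (by omega) he
        omega
    · intro t ht
      rcases prismWind_cases p n i j (β - 1) t with ⟨h1, e1⟩ | ⟨h1, h1', e1⟩ | ⟨h1, e1⟩ <;> rw [e1]
      · rw [hC.adj_iff_same hβ (by omega)]
        omega
      · rw [hC.adj_iff i j hij _ _ hβ (by omega)]
        omega
      · rw [hC.adj_iff_same hβ (by omega)]
        omega
    · rintro v (rfl | rfl | rfl | ⟨q, h1, h2, rfl⟩)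
      · exact Or.inr (Or.inl rfl)
      · exact Or.inl rfl
      · refine Or.inr (Or.inr fun t ht => ?_)
        rcases prismWind_cases p n i j (β - 1) t with ⟨h1, e1⟩ | ⟨h1, h1', e1⟩ | ⟨h1, e1⟩ <;>
          rw [e1]
        · refine ⟨hxK _ _ (by omega), fun h2 => ?_⟩
          have := hmin _ h2
          omega
        · exact ⟨hxK _ _ (by omega), hxj _ (by omega)⟩
        · refine ⟨hxK _ _ (by omega), fun h2 => ?_⟩
          have := hmax _ (by omega) h2
          omega
      · exact Or.inr (Or.inr (hkanti (by omega) (by omega) q h1 h2))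
    · intro t ht h1
      have := hC.stub w hwK i t ht h1
      have := hwi t ht h1
      omega
    · intro t ht h1
      have := hC.stub w hwK j t ht h1
      omega
  · refine hC.not_adj_of_consecutive hh hxK hij hik hjk (c := r) hβ ?_ hxj hc hxc
    intro t ht
    refine ⟨fun h1 => ?_, ?_⟩
    · have h2 := hmin t h1
      have h3 := hmax t ht h1
      omega
    · rintro (rfl | rfl)
      · exact hxr
      · exact hxβ
  · refine hC.false_of_prismWind hh hnt hwK hij hik hjk (r := r) (β := β)
      (N := r + n j + 2 + (n i - β)) hrβ2 hβ (by omega) le_rfl (e := x)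
      ?_ ?_ hwx hwx' hwxT ?_ ?_ ?_ hex hwk
    · intro t ht
      rcases prismWind_cases p n i j r t with ⟨h1, e1⟩ | ⟨h1, h1', e1⟩ | ⟨h1, e1⟩ <;> rw [e1] <;>
        exact hxK _ _ (by omega)
    · intro t ht
      rcases prismWind_cases p n i j r t with ⟨h1, e1⟩ | ⟨h1, h1', e1⟩ | ⟨h1, e1⟩ <;> rw [e1]
      · refine ⟨fun h2 => ?_, fun h2 => ?_⟩
        · have := hmin _ h2
          omega
        · rwa [show r - t = r by omega]
      · exact ⟨fun h2 => (hxj _ (by omega) h2).elim, by omega⟩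
      · refine ⟨fun h2 => ?_, fun h2 => ?_⟩
        · have := hmax _ (by omega) h2
          omega
        · rwa [show n i + (r + n j + 2) - t = β by omega]
    · rintro v (rfl | rfl | ⟨q, h1, h2, rfl⟩)
      · exact Or.inl rfl
      · exact Or.inr (Or.inl rfl)
      · exact Or.inr (Or.inr (hkanti (by omega) (by omega) q h1 h2))
    · intro t ht h1
      have := hC.stub w hwK i t ht h1
      have := hwi t ht h1
      omega
    · intro t ht h1
      have := hC.stub w hwK j t ht h1
      omega

end PrismCoords

theorem InducedSeq.false_of_unique_adj {V : Type*} {G : SimpleGraph V} {f : ℕ → V} {N t : ℕ}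
    (hf : InducedSeq G f N) (h0 : 0 < t) (hN : t < N) (hfst : ¬ G.Adj (f t) (f 0))
    (hlst : ¬ G.Adj (f t) (f N))
    (huniq : ∀ a b, 0 < a → a < N → 0 < b → b < N → G.Adj (f t) (f a) → G.Adj (f t) (f b) →
      f a = f b) : False := by
  have hl : G.Adj (f t) (f (t - 1)) := (hf t (t - 1) (by omega) (by omega)).2.2 (by omega)
  have hr : G.Adj (f t) (f (t + 1)) := (hf t (t + 1) (by omega) (by omega)).2.2 (by omega)
  have hl0 : t - 1 ≠ 0 := fun h => hfst (h ▸ hl)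
  have hrN : t + 1 ≠ N := fun h => hlst (h ▸ hr)
  have he := huniq (t - 1) (t + 1) (by omega) (by omega) (by omega) (by omega) hl hr
  have := (hf (t - 1) (t + 1) (by omega) (by omega)).1 he
  omega

/-- The vertices of a path up to position `r` are those up to the first neighbour of `x`. -/
def IsCut {V : Type*} (G : SimpleGraph V) (x : V) (f : ℕ → V) (N r : ℕ) : Prop :=
  r ≤ N ∧ (∀ t, t < r → ¬ G.Adj x (f t)) ∧ (G.Adj x (f r) ∨ r = N)

theorem exists_isCut {V : Type*} (G : SimpleGraph V) (x : V) (f : ℕ → V) (N : ℕ) :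
    ∃ r, IsCut G x f N r := by
  by_cases hx : ∃ t, t ≤ N ∧ G.Adj x (f t)
  · obtain ⟨t, ht, hadj⟩ := hx
    obtain ⟨r, hr, hxr, hmin⟩ := exists_least_le (p := fun t => G.Adj x (f t)) ht hadj
    exact ⟨r, hr, hmin, Or.inl hxr⟩
  · exact ⟨N, le_rfl, fun t ht hadj => hx ⟨t, ht.le, hadj⟩, Or.inr rfl⟩

theorem IsCut.not_adj {V : Type*} {G : SimpleGraph V} {x : V} {f : ℕ → V} {N r : ℕ}
    (hr : IsCut G x f N r) (hxr : ¬ G.Adj x (f r)) : ∀ t, t ≤ N → ¬ G.Adj x (f t) := by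
  obtain ⟨-, hmin, hxN⟩ := hr
  intro t ht hadj
  rcases (hxN.resolve_left hxr ▸ ht).lt_or_eq with h1 | rfl
  · exact hmin t h1 hadj
  · exact hxr hadj

namespace PrismCoords

variable {V : Type*} {G : SimpleGraph V} {h : ℕ} {p : Fin 3 → ℕ → V} {n : Fin 3 → ℕ}

theorem not_adj_end (hC : PrismCoords G h p n) (hh : 3 ≤ h) {w : V}
    (hwK : ∀ i t, t ≤ n i → w ≠ p i t) {i : Fin 3} {t : ℕ} (ht : t = 0 ∨ t = n i) :
    ¬ G.Adj (p i t) w := fun hadj => by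
  have := hC.stub w hwK i t (by omega) hadj.symm
  omega

/-- The interior of an induced path contained in one constituent path avoids its ends. -/
theorem interior_bounds (hC : PrismCoords G h p n) (hh : 3 ≤ h) {k : Fin 3} {f : ℕ → V} {N : ℕ}
    (hf : InducedSeq G f N) (hfst : ∀ i t, t ≤ n i → f 0 ≠ p i t)
    (hlst : ∀ i t, t ≤ n i → f N ≠ p i t)
    (hmem : ∀ a, 0 < a → a < N → ∃ t, t ≤ n k ∧ f a = p k t)
    {a t : ℕ} (ha : 0 < a) (haN : a < N) (ht : t ≤ n k) (hat : f a = p k t) :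
    0 < t ∧ t < n k := by
  by_contra hcon
  have hend : t = 0 ∨ t = n k := by omega
  refine hf.false_of_unique_adj ha haN ?_ ?_ ?_
  · rw [hat]
    exact hC.not_adj_end hh hfst hend
  · rw [hat]
    exact hC.not_adj_end hh hlst hend
  · intro b c hb hbN hc hcN hab hac
    obtain ⟨u, hu, hbu⟩ := hmem b hb hbN
    obtain ⟨v, hv, hcv⟩ := hmem c hc hcN
    rw [hat, hbu, hC.adj_iff_same ht hu] at hab
    rw [hat, hcv, hC.adj_iff_same ht hv] at hac
    rw [hbu, hcv, show u = v by omega]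

/-- The interior of an induced path contained in initial segments of two constituent paths, not
both complete, avoids the last vertices of those paths. -/
theorem interior_lt (hC : PrismCoords G h p n) (hh : 3 ≤ h) {i j : Fin 3} (hij : i ≠ j) {r s : ℕ}
    (hr : r ≤ n i) (hs : s ≤ n j) (hrs : r < n i ∨ s < n j) {f : ℕ → V} {N : ℕ}
    (hf : InducedSeq G f N) (hfst : ∀ i t, t ≤ n i → f 0 ≠ p i t)
    (hlst : ∀ i t, t ≤ n i → f N ≠ p i t)
    (hmem : ∀ a, 0 < a → a < N → (∃ t, t ≤ r ∧ f a = p i t) ∨ ∃ t, t ≤ s ∧ f a = p j t)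
    {a t : ℕ} (ha : 0 < a) (haN : a < N) (ht : t ≤ s) (hat : f a = p j t) : t < n j := by
  by_contra hcon
  have hend : t = 0 ∨ t = n j := by omega
  have key : ∀ b, 0 < b → b < N → G.Adj (f a) (f b) →
      (n j = 0 ∧ f b = p i 0) ∨ (0 < n j ∧ f b = p j (n j - 1)) := by
    intro b hb hbN hab
    rcases hmem b hb hbN with ⟨u, hu, hbu⟩ | ⟨u, hu, hbu⟩
    · rw [hat, hbu, hC.adj_iff j i hij.symm _ _ (by omega) (by omega)] at hab
      exact Or.inl ⟨by omega, by rw [hbu, show u = 0 by omega]⟩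
    · rw [hat, hbu, hC.adj_iff_same (by omega) (by omega)] at hab
      exact Or.inr ⟨by omega, by rw [hbu, show u = n j - 1 by omega]⟩
  refine hf.false_of_unique_adj ha haN ?_ ?_ ?_
  · rw [hat]
    exact hC.not_adj_end hh hfst hend
  · rw [hat]
    exact hC.not_adj_end hh hlst hend
  · intro b c hb hbN hc hcN hab hac
    rcases key b hb hbN hab with ⟨h1, e1⟩ | ⟨h1, e1⟩ <;>
    rcases key c hc hcN hac with ⟨h2, e2⟩ | ⟨h2, e2⟩ <;>
    first
    | omega
    | rw [e1, e2]

/-- Two paths, through initial segments of two constituent paths and through the third, form a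
long theta with a path through the rest of the first two. -/
theorem hasLongTheta_of_adj_tail (hC : PrismCoords G h p n) (hh : 3 ≤ h)
    {i j k : Fin 3} (hij : i ≠ j) (hik : i ≠ k) (hjk : j ≠ k) {r s : ℕ}
    (hr : r ≤ n i) (hs : s ≤ n j) (hrs : r < n i ∨ s < n j) {f g : ℕ → V} {N M : ℕ}
    (hf : InducedSeq G f N) (hg : InducedSeq G g M) (hfg : f 0 = g 0) (hfg' : f N = g M)
    (hN : 2 * h - 2 ≤ N) (hM : 2 * h - 2 ≤ M)
    (hfst : ∀ i t, t ≤ n i → f 0 ≠ p i t) (hlst : ∀ i t, t ≤ n i → f N ≠ p i t)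
    (hfint : ∀ a, 0 < a → a < N → (∃ t, t ≤ r ∧ f a = p i t) ∨ ∃ t, t ≤ s ∧ f a = p j t)
    (hgint : ∀ a, 0 < a → a < M → ∃ t, t ≤ n k ∧ g a = p k t)
    (htail : ∀ w, w = f 0 ∨ w = f N → (∃ t, r + 2 ≤ t ∧ t ≤ n i ∧ G.Adj w (p i t)) ∨
      ∃ t, s + 2 ≤ t ∧ t ≤ n j ∧ G.Adj w (p j t)) : HasLongTheta G (2 * h) := by
  have hne : f 0 ≠ f N := fun he => by
    have := (hf 0 N (by omega) le_rfl).1 he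
    omega
  have hnadj : ¬ G.Adj (f 0) (f N) := fun he => by
    have := (hf 0 N (by omega) le_rfl).2.1 he
    omega
  let T : Set V := {v | v = f 0 ∨ v = f N ∨ (∃ t, r + 2 ≤ t ∧ t ≤ n i ∧ v = p i t) ∨
    ∃ t, s + 2 ≤ t ∧ t ≤ n j ∧ v = p j t}
  have hiT : ∀ t, r + 2 ≤ t → t ≤ n i → p i t ∈ T := fun t h1 h2 =>
    Or.inr (Or.inr (Or.inl ⟨t, h1, h2, rfl⟩))
  have hjT : ∀ t, s + 2 ≤ t → t ≤ n j → p j t ∈ T := fun t h1 h2 =>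
    Or.inr (Or.inr (Or.inr ⟨t, h1, h2, rfl⟩))
  have hreach : ∀ w, w = f 0 ∨ w = f N → (p i (n i) ∈ T ∧ JoinedInside G T w (p i (n i))) ∨
      (p j (n j) ∈ T ∧ JoinedInside G T w (p j (n j))) := by
    intro w hw
    have hwT : w ∈ T := hw.imp_right Or.inl
    rcases htail w hw with ⟨t, h1, h2, h3⟩ | ⟨t, h1, h2, h3⟩
    · exact Or.inl ⟨hiT _ (by omega) le_rfl, (JoinedInside.of_adj hwT (hiT t h1 h2) h3).trans
        (hC.joinedInside hiT le_rfl h1 h2 (by omega) le_rfl)⟩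
    · exact Or.inr ⟨hjT _ (by omega) le_rfl, (JoinedInside.of_adj hwT (hjT t h1 h2) h3).trans
        (hC.joinedInside hjT le_rfl h1 h2 (by omega) le_rfl)⟩
  have hbb : G.Adj (p i (n i)) (p j (n j)) :=
    (hC.adj_iff i j hij _ _ le_rfl le_rfl).2 (Or.inr ⟨rfl, rfl⟩)
  have hT : JoinedInside G T (f 0) (f N) := by
    rcases hreach _ (Or.inl rfl) with ⟨h1, h2⟩ | ⟨h1, h2⟩ <;>
    rcases hreach _ (Or.inr rfl) with ⟨h3, h4⟩ | ⟨h3, h4⟩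
    · exact h2.trans h4.symm
    · exact (h2.trans (JoinedInside.of_adj h1 h3 hbb)).trans h4.symm
    · exact (h2.trans (JoinedInside.of_adj h1 h3 hbb.symm)).trans h4.symm
    · exact h2.trans h4.symm
  obtain ⟨S, d, hS, hST⟩ := hT.exists_inducedPathOn
  have hd := hS.two_le hne hnadj
  have hP := InducedPathOn.of_seq hf (Nat.zero_le N) le_rfl
  have hQ := InducedPathOn.of_seq hg (Nat.zero_le M) le_rfl
  rw [← hfg, ← hfg'] at hQ
  have hfi : ∀ a t, 0 < a → a < N → t ≤ r → f a = p i t → t < n i := fun a t ha haN ht hat =>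
    hC.interior_lt hh hij.symm hs hr hrs.symm hf hfst hlst
      (fun a ha haN => (hfint a ha haN).symm) ha haN ht hat
  have hfj : ∀ a t, 0 < a → a < N → t ≤ s → f a = p j t → t < n j := fun a t ha haN ht hat =>
    hC.interior_lt hh hij hr hs hrs hf hfst hlst hfint ha haN ht hat
  have hgk : ∀ a t, 0 < a → a < M → t ≤ n k → g a = p k t → 0 < t ∧ t < n k :=
    fun a t ha haM ht hat => hC.interior_bounds hh hg (hfg ▸ hfst) (hfg' ▸ hlst) hgint ha haM ht hat
  have hfk : ∀ q, q ≠ k → ∀ t c, t ≤ n q → 0 < c → c < n k →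
      ¬ (p q t = p k c ∨ G.Adj (p q t) (p k c)) := by
    rintro q hqk t c ht hc hck (h1 | h1)
    · exact hC.ne q k hqk _ _ ht (by omega) h1
    · rw [hC.adj_iff q k hqk _ _ ht (by omega)] at h1
      omega
  refine hasLongTheta_of_inducedPathOn hne hnadj hP hQ hS ?_ ?_ ?_ (by omega) (by omega) (by omega)
  · rintro _ ⟨a, -, ha, rfl⟩ _ ⟨b, -, hb, rfl⟩ hxy
    by_cases ha0 : a = 0
    · exact Or.inl (by rw [ha0])
    by_cases haN : a = N
    · exact Or.inr (Or.inl (by rw [haN]))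
    by_cases hb0 : b = 0
    · exact Or.inr (Or.inr (Or.inl (by rw [hb0, hfg])))
    by_cases hbM : b = M
    · exact Or.inr (Or.inr (Or.inr (by rw [hbM, hfg'])))
    exfalso
    obtain ⟨c, hc, hbc⟩ := hgint b (by omega) (by omega)
    have hcb := hgk b c (by omega) (by omega) hc hbc
    rw [hbc] at hxy
    rcases hfint a (by omega) (by omega) with ⟨t, ht, hat⟩ | ⟨t, ht, hat⟩ <;> rw [hat] at hxy
    · exact hfk i hik t c (by omega) hcb.1 hcb.2 hxy
    · exact hfk j hjk t c (by omega) hcb.1 hcb.2 hxy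
  · rintro _ ⟨a, -, ha, rfl⟩ v hv hxy
    by_cases ha0 : a = 0
    · exact Or.inl (by rw [ha0])
    by_cases haN : a = N
    · exact Or.inr (Or.inl (by rw [haN]))
    have hiv := hfi a
    have hjv := hfj a
    rcases hST hv with hv | hv | ⟨c, hrc, hc, rfl⟩ | ⟨c, hrc, hc, rfl⟩
    · exact Or.inr (Or.inr (Or.inl hv))
    · exact Or.inr (Or.inr (Or.inr hv))
    · exfalso
      rcases hfint a (by omega) (by omega) with ⟨t, ht, hat⟩ | ⟨t, ht, hat⟩ <;> rw [hat] at hxy <;>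
        rcases hxy with hxy | hxy
      · have := hC.eq_of_eq (by omega) hc hxy
        omega
      · rw [hC.adj_iff_same (by omega) hc] at hxy
        omega
      · exact hC.ne j i hij.symm _ _ (by omega) hc hxy
      · have := hjv t (by omega) (by omega) ht hat
        rw [hC.adj_iff j i hij.symm _ _ (by omega) hc] at hxy
        omega
    · exfalso
      rcases hfint a (by omega) (by omega) with ⟨t, ht, hat⟩ | ⟨t, ht, hat⟩ <;> rw [hat] at hxy <;>
        rcases hxy with hxy | hxy
      · exact hC.ne i j hij _ _ (by omega) hc hxy
      · have := hiv t (by omega) (by omega) ht hat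
        rw [hC.adj_iff i j hij _ _ (by omega) hc] at hxy
        omega
      · have := hC.eq_of_eq (by omega) hc hxy
        omega
      · rw [hC.adj_iff_same (by omega) hc] at hxy
        omega
  · rintro _ ⟨b, -, hb, rfl⟩ v hv hxy
    by_cases hb0 : b = 0
    · exact Or.inl (by rw [hb0, hfg])
    by_cases hbM : b = M
    · exact Or.inr (Or.inl (by rw [hbM, hfg']))
    obtain ⟨c, hc, hbc⟩ := hgint b (by omega) (by omega)
    have hcb := hgk b c (by omega) (by omega) hc hbc
    rw [hbc] at hxy
    replace hxy := hxy.imp Eq.symm SimpleGraph.Adj.symm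
    rcases hST hv with hv | hv | ⟨t, -, ht, rfl⟩ | ⟨t, -, ht, rfl⟩
    · exact Or.inr (Or.inr (Or.inl hv))
    · exact Or.inr (Or.inr (Or.inr hv))
    · exact (hfk i hik t c ht hcb.1 hcb.2 hxy).elim
    · exact (hfk j hjk t c ht hcb.1 hcb.2 hxy).elim

/-- A vertex distant from `x` with neighbours on the third constituent path and on one of the
first two has a neighbour on the rest of the first two. -/
theorem exists_adj_tail (hC : PrismCoords G h p n) (hh : 3 ≤ h)
    (hnt : ¬ HasLongTheta G (2 * h)) {x w : V} (hxK : ∀ i t, t ≤ n i → x ≠ p i t)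
    (hmaj : ∀ i c, c ≤ n i → ∃ j t, t ≤ n j ∧ G.Adj x (p j t) ∧ ¬ (j = i ∧ c ≤ t ∧ t ≤ c + 2))
    (hwK : ∀ i t, t ≤ n i → w ≠ p i t) (hwx : w ≠ x) (hwx' : ¬ G.Adj w x)
    (hnear : ∀ q c, c ≤ n q → G.Adj x (p q c) → (∀ t, t < c → ¬ G.Adj x (p q t)) →
      ∀ t, t ≤ n q → G.Adj w (p q t) → t + (2 * h - 2) < c ∨ c + 1 < t)
    {i j k : Fin 3} (hij : i ≠ j) (hik : i ≠ k) (hjk : j ≠ k) {r s : ℕ}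
    (hr : IsCut G x (p i) (n i) r) (hs : IsCut G x (p j) (n j) s)
    (hex : (∃ t, t ≤ n i ∧ G.Adj w (p i t)) ∨ ∃ t, t ≤ n j ∧ G.Adj w (p j t))
    (hwk : ∃ t, t ≤ n k ∧ G.Adj w (p k t)) :
    (∃ t, r + 2 ≤ t ∧ t ≤ n i ∧ G.Adj w (p i t)) ∨
      ∃ t, s + 2 ≤ t ∧ t ≤ n j ∧ G.Adj w (p j t) := by
  by_contra hcon
  push Not at hcon
  obtain ⟨hi, hj⟩ := hcon
  have hwi : G.Adj x (p i r) → ∀ t, t ≤ n i → G.Adj w (p i t) → t + (2 * h - 2) < r :=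
    fun hxr t ht hadj => (hnear i r hr.1 hxr hr.2.1 t ht hadj).resolve_right
      fun h1 => hi t h1 ht hadj
  have hwj : G.Adj x (p j s) → ∀ t, t ≤ n j → G.Adj w (p j t) → t + (2 * h - 2) < s :=
    fun hxs t ht hadj => (hnear j s hs.1 hxs hs.2.1 t ht hadj).resolve_right
      fun h1 => hj t h1 ht hadj
  by_cases hxr : G.Adj x (p i r) <;> by_cases hxs : G.Adj x (p j s)
  · exact hC.false_of_adj_both hh hnt hxK hwK hwx hwx' hij hik hjk hr.1 hxr hr.2.1 hs.1 hxs hs.2.1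
      (hwi hxr) (hwj hxs) hex hwk
  · exact hC.false_of_adj_one hh hnt hxK hwK hwx hwx' hij hik hjk hr.1 hxr hr.2.1 (hs.not_adj hxs)
      (hC.exists_adj_of_spread hh hxK hmaj hjk (hs.not_adj hxs)) (hwi hxr) hex hwk
  · exact hC.false_of_adj_one hh hnt hxK hwK hwx hwx' hij.symm hjk hik hs.1 hxs hs.2.1
      (hr.not_adj hxr) (hC.exists_adj_of_spread hh hxK hmaj hik (hr.not_adj hxr)) (hwj hxs)
      hex.symm hwk
  · obtain ⟨t, ht, hadj⟩ := hC.exists_adj_of_spread hh hxK hmaj hij (hr.not_adj hxr)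
    exact hs.not_adj hxs t ht hadj

theorem isCut_lt (hC : PrismCoords G h p n) (hh : 3 ≤ h) {x : V}
    (hxK : ∀ i t, t ≤ n i → x ≠ p i t)
    (hmaj : ∀ i c, c ≤ n i → ∃ j t, t ≤ n j ∧ G.Adj x (p j t) ∧ ¬ (j = i ∧ c ≤ t ∧ t ≤ c + 2))
    {i j : Fin 3} (hij : i ≠ j) {r s : ℕ}
    (hr : IsCut G x (p i) (n i) r) (hs : IsCut G x (p j) (n j) s) : r < n i ∨ s < n j := by
  by_cases hxr : G.Adj x (p i r)
  · have := hC.stub x hxK i r hr.1 hxr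
    omega
  by_cases hxs : G.Adj x (p j s)
  · have := hC.stub x hxK j s hs.1 hxs
    omega
  obtain ⟨t, ht, hadj⟩ := hC.exists_adj_of_spread hh hxK hmaj hij (hr.not_adj hxr)
  exact (hs.not_adj hxs t ht hadj).elim

end PrismCoords

section Interior

variable {V : Type*} {G : SimpleGraph V} {u v : V} {Q : G.Walk u v}

theorem LEH.IsInducedPath.getVert_mem_inter (hQ : IsInducedPath Q) {t : ℕ} (h0 : 0 < t)
    (ht : t < Q.length) : Q.getVert t ∈ inter Q := by
  refine ⟨Q.getVert_mem_support t, fun he => ?_, fun he => ?_⟩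
  · have := (hQ.inducedSeq t 0 ht.le (Nat.zero_le _)).1 (by rw [he, Q.getVert_zero])
    omega
  · have := (hQ.inducedSeq t Q.length ht.le le_rfl).1 (by rw [he, Q.getVert_length])
    omega

theorem LEH.IsInducedPath.exists_adj_of_inter_subset (hQ : IsInducedPath Q) (hl : 2 ≤ Q.length)
    {X : Set V} (hX : inter Q ⊆ X) {w : V} (hw : w = u ∨ w = v) : ∃ c ∈ X, G.Adj w c := by
  rcases hw with rfl | rfl
  · refine ⟨Q.getVert 1, hX (hQ.getVert_mem_inter one_pos (by omega)), ?_⟩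
    have := (hQ.inducedSeq 0 1 (Nat.zero_le _) (by omega)).2.2 (Or.inl rfl)
    rwa [Q.getVert_zero] at this
  · refine ⟨Q.getVert (Q.length - 1), hX (hQ.getVert_mem_inter (by omega) (by omega)), ?_⟩
    have := (hQ.inducedSeq Q.length (Q.length - 1) le_rfl (by omega)).2.2 (by omega)
    rwa [Q.getVert_length] at this

end Interior

/-- for nonadjacent `y, z` both distant from `x`, there is no long pair of
`yz`-paths through `A_{i,j}(x)` and through `V(P k)`. -/
theorem twotriangles {V : Type*} [Fintype V]
    (ℓ : ℕ) (hℓ : 6 ≤ ℓ) (hℓeven : Even ℓ)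
    (G : SimpleGraph V) (hnt : ¬ HasLongTheta G ℓ)
    {a b : Fin 3 → V} (P : ∀ i : Fin 3, G.Walk (a i) (b i))
    (hsh : ShortestLNP G ℓ P) (htidy : Tidy G ℓ P)
    (x y z : V) (hx : KMajor G P x) (hy : KMajor G P y) (hz : KMajor G P z)
    (hdy : Distant G ℓ P x y) (hdz : Distant G ℓ P x z) (hyz : ¬ G.Adj y z) :
    ∀ i j k : Fin 3, i ≠ j → i ≠ k → j ≠ k →
      (¬ ∃ Q : G.Walk y z, IsInducedPath Q ∧ ℓ - 2 ≤ Q.length ∧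
          inter Q ⊆ Aset G (P i) x ∪ Aset G (P j) x) ∨
      (¬ ∃ Q : G.Walk y z, IsInducedPath Q ∧ ℓ - 2 ≤ Q.length ∧
          inter Q ⊆ vset (P k)) := by
  intro i j k hij hik hjk
  by_contra hcon
  push Not at hcon
  obtain ⟨⟨Q, hQ, hQl, hQA⟩, R, hR, hRl, hRk⟩ := hcon
  obtain ⟨h, rfl⟩ := hℓeven.exists_two_nsmul
  rw [smul_eq_mul] at *
  have hh : 3 ≤ h := by omega
  have hC := prismCoords hh hsh htidy
  have hxK : ∀ i t, t ≤ (P i).length → x ≠ (P i).getVert t := fun i t ht => hx.ne_getVert ht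
  have hmaj := fun i c (hc : c ≤ (P i).length) => hx.exists_adj hsh.1 i hc
  obtain ⟨r, hr⟩ := exists_isCut G x (P i).getVert (P i).length
  obtain ⟨s, hs⟩ := exists_isCut G x (P j).getVert (P j).length
  have hA : ∀ {q c}, IsCut G x (P q).getVert (P q).length c → ∀ v ∈ Aset G (P q) x,
      ∃ t, t ≤ c ∧ v = (P q).getVert t := by
    rintro q c hc v hv
    rcases hc.2.2 with hxc | rfl
    · exact mem_Aset_of_adj hc.1 hxc hc.2.1 hv
    · exact (mem_vset_iff _ _).1 (Aset_subset_vset hv)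
  have hwdist : ∀ w, w = y ∨ w = z → KMajor G P w ∧ Distant G (2 * h) P x w := by
    rintro w (rfl | rfl)
    · exact ⟨hy, hdy⟩
    · exact ⟨hz, hdz⟩
  have htail : ∀ w, w = y ∨ w = z →
      (∃ t, r + 2 ≤ t ∧ t ≤ (P i).length ∧ G.Adj w ((P i).getVert t)) ∨
        ∃ t, s + 2 ≤ t ∧ t ≤ (P j).length ∧ G.Adj w ((P j).getVert t) := by
    intro w hw
    obtain ⟨hwM, hd⟩ := hwdist w hw
    have hnear := fun q c (hc : c ≤ (P q).length) hxc hmin t (ht : t ≤ (P q).length) hwt =>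
      hd.not_adj_near hh hsh htidy hx hwM hc hxc hmin ht hwt
    refine hC.exists_adj_tail hh hnt hxK hmaj (fun i t ht => hwM.ne_getVert ht) ?_
      (fun h => hd.1 h.symm) hnear hij hik hjk hr hs ?_ ?_
    · rintro rfl
      obtain ⟨q, t, ht, hadj, -⟩ := hx.exists_adj hsh.1 0 (Nat.zero_le _)
      obtain ⟨c, hc, hxc, hmin⟩ :=
        exists_least_le (p := fun t => G.Adj w ((P q).getVert t)) ht hadj
      have := hnear q c hc hxc hmin c hc hxc
      omega
    · obtain ⟨v, hv | hv, hwv⟩ := hQ.exists_adj_of_inter_subset (by omega) hQA hw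
      · obtain ⟨t, ht, rfl⟩ := hA hr v hv
        exact Or.inl ⟨t, ht.trans hr.1, hwv⟩
      · obtain ⟨t, ht, rfl⟩ := hA hs v hv
        exact Or.inr ⟨t, ht.trans hs.1, hwv⟩
    · obtain ⟨v, hv, hwv⟩ := hR.exists_adj_of_inter_subset (by omega) hRk hw
      obtain ⟨t, ht, rfl⟩ := (mem_vset_iff _ _).1 hv
      exact ⟨t, ht, hwv⟩
  refine hnt (hC.hasLongTheta_of_adj_tail hh hij hik hjk hr.1 hs.1
    (hC.isCut_lt hh hxK hmaj hij hr hs) hQ.inducedSeq hR.inducedSeq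
    (by rw [Q.getVert_zero, R.getVert_zero]) (by rw [Q.getVert_length, R.getVert_length])
    hQl hRl ?_ ?_ ?_ ?_ ?_)
  · rw [Q.getVert_zero]
    exact fun i t ht => hy.ne_getVert ht
  · rw [Q.getVert_length]
    exact fun i t ht => hz.ne_getVert ht
  · intro c hc hcl
    exact (hQA (hQ.getVert_mem_inter hc hcl)).imp (hA hr _) (hA hs _)
  · intro c hc hcl
    exact (mem_vset_iff _ _).1 (hRk (hR.getVert_mem_inter hc hcl))
  · rw [Q.getVert_zero, Q.getVert_length]
    exact htail
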